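/- Let k be a positive even integer and let N ∈ {18, 20, 24}. Let (a_n)_{n≥1} be complex numbers with a_n = O(n^σ) for some σ > 0, and for Re(s) > σ + 1 set L_f(s) = Σ_{n≥1} a_n n^{−s}. Assume: (1) for Re(s) > σ + 1 the series L_f(s) admits the Euler product L_f(s) = ∏_{p prime, p ∤ N} (1 − a_p p^{−s} + p^{k−1−2s})^{−1} · ∏_{p prime, p | N, p² ∤ N} (1 − p^{k/2−1−s})^{−1}; (2) the completed L-function Λ_f(s) = (2π)^{−s} Γ(s) L_f(s) extends to an entire function on ℂ which is bounded on every vertical strip {s : a ≤ Re(s) ≤ b} and satisfies the functional equation Λ_f(s) = (−1)^{k/2} N^{k/2−s} Λ_f(k − s). Then the function f(z) = Σ_{n≥1} a_n exp(2πinz) is a modular form of weight k on Γ₀(N): f is holomorphic on the upper half-plane ℍ, satisfies f((az+b)/(cz+d)) = (cz+d)^k f(z) for every matrix [[a,b],[c,d]] ∈ Γ₀(N), and is holomorphic at every cusp of Γ₀(N). -/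

import Mathlib

open Complex UpperHalfPlane

/-- The coefficients of the power series `1 / (1 - α X + β X ^ 2)`. -/
def quadCoeff (α β : ℂ) : ℕ → ℂ
  | 0 => 1
  | 1 => α
  | n + 2 => α * quadCoeff α β (n + 1) - β * quadCoeff α β n

/-- The multiplicative function whose Dirichlet series has the Euler factors
`(1 - α p * p ^ (-s) + β p * p ^ (-2s))⁻¹`. -/
def eulerCoeff (α β : ℕ → ℂ) (n : ℕ) : ℂ :=
  if n = 0 then 0 else n.factorization.prod fun p j => quadCoeff (α p) (β p) j

lemma norm_quadCoeff_le {α β : ℂ} {R : ℝ} (hα : ‖α‖ ≤ R / 2) (hβ : ‖β‖ ≤ R ^ 2 / 2) (n : ℕ) :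
    ‖quadCoeff α β n‖ ≤ R ^ n := by
  have hR : 0 ≤ R := by linarith [norm_nonneg α]
  induction n using Nat.twoStepInduction with
  | zero => simp [quadCoeff]
  | one => simp only [quadCoeff, pow_one]; linarith
  | more n h1 h2 =>
    calc ‖quadCoeff α β (n + 2)‖ ≤ ‖α‖ * ‖quadCoeff α β (n + 1)‖ + ‖β‖ * ‖quadCoeff α β n‖ := by
          rw [quadCoeff, ← norm_mul, ← norm_mul]; exact norm_sub_le _ _
      _ ≤ R / 2 * R ^ (n + 1) + R ^ 2 / 2 * R ^ n := by gcongr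
      _ = R ^ (n + 2) := by ring

lemma hasSum_quadCoeff {α β x : ℂ} {R : ℝ} (hα : ‖α‖ ≤ R / 2) (hβ : ‖β‖ ≤ R ^ 2 / 2)
    (hx : R * ‖x‖ < 1) :
    HasSum (fun n => quadCoeff α β n * x ^ n) (1 - α * x + β * x ^ 2)⁻¹ := by
  have hR : 0 ≤ R := by linarith [norm_nonneg α]
  have hs : Summable (fun n => quadCoeff α β n * x ^ n) := by
    refine Summable.of_norm_bounded
      (summable_geometric_of_lt_one (by positivity : 0 ≤ R * ‖x‖) hx) fun n => ?_
    rw [norm_mul, norm_pow, mul_pow]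
    gcongr
    exact norm_quadCoeff_le hα hβ n
  have h1 := (summable_nat_add_iff 1).2 hs
  have e0 := hs.tsum_eq_zero_add
  have e1 := h1.tsum_eq_zero_add
  have e2 : ∑' n, quadCoeff α β (n + 1 + 1) * x ^ (n + 1 + 1) =
      α * x * (∑' n, quadCoeff α β (n + 1) * x ^ (n + 1)) -
        β * x ^ 2 * ∑' n, quadCoeff α β n * x ^ n := by
    rw [← tsum_mul_left, ← tsum_mul_left, ← Summable.tsum_sub (h1.mul_left _) (hs.mul_left _)]
    refine tsum_congr fun n => ?_
    rw [quadCoeff]; ring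
  have key : (1 - α * x + β * x ^ 2) * ∑' n, quadCoeff α β n * x ^ n = 1 := by
    have q0 : quadCoeff α β 0 = 1 := rfl
    have q1 : quadCoeff α β 1 = α := rfl
    rw [e2] at e1
    simp only [q0, q1, pow_zero, mul_one, zero_add, pow_one] at e0 e1
    linear_combination e0 + e1 - α * x * e0
  have hne : (1 - α * x + β * x ^ 2) ≠ 0 := by
    rintro h; rw [h, zero_mul] at key; exact zero_ne_one key
  rw [← eq_inv_of_mul_eq_one_right key]
  exact hs.hasSum

section eulerCoeff

variable (α β : ℕ → ℂ)

lemma eulerCoeff_one : eulerCoeff α β 1 = 1 := by simp [eulerCoeff]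

lemma eulerCoeff_mul {m n : ℕ} (h : m.Coprime n) :
    eulerCoeff α β (m * n) = eulerCoeff α β m * eulerCoeff α β n := by
  rcases eq_or_ne m 0 with rfl | hm
  · simp [eulerCoeff]
  rcases eq_or_ne n 0 with rfl | hn
  · simp [eulerCoeff]
  simp only [eulerCoeff, mul_eq_zero, hm, hn, or_self, if_false]
  rw [Nat.factorization_mul_of_coprime h,
    ← Finsupp.prod_add_index_of_disjoint (by simpa using h.disjoint_primeFactors)]

lemma eulerCoeff_prime_pow {p : ℕ} (hp : p.Prime) (j : ℕ) :
    eulerCoeff α β (p ^ j) = quadCoeff (α p) (β p) j := by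
  rw [eulerCoeff, if_neg (pow_pos hp.pos j).ne', hp.factorization_pow,
    Finsupp.prod_single_index (by simp [quadCoeff])]

lemma norm_eulerCoeff_le {B : ℕ} (hα : ∀ p : ℕ, p.Prime → ‖α p‖ ≤ (p : ℝ) ^ B / 2)
    (hβ : ∀ p : ℕ, p.Prime → ‖β p‖ ≤ ((p : ℝ) ^ B) ^ 2 / 2) (n : ℕ) :
    ‖eulerCoeff α β n‖ ≤ (n : ℝ) ^ B := by
  rcases eq_or_ne n 0 with rfl | hn
  · simp [eulerCoeff]
  rw [eulerCoeff, if_neg hn]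
  conv_rhs => rw [← Nat.prod_factorization_pow_eq_self hn]
  simp only [Finsupp.prod, norm_prod, Nat.cast_prod, ← Finset.prod_pow]
  refine Finset.prod_le_prod (fun _ _ => norm_nonneg _) fun p hp => ?_
  have hp' : p.Prime := Nat.prime_of_mem_primeFactors (by simpa using hp)
  refine (norm_quadCoeff_le (hα p hp') (hβ p hp') _).trans (le_of_eq ?_)
  push_cast
  ring

lemma eulerCoeff_prime_mul {p : ℕ} (hp : p.Prime) {n : ℕ} (hn : n ≠ 0) :
    eulerCoeff α β (p * n) =
      α p * eulerCoeff α β n - if p ∣ n then β p * eulerCoeff α β (n / p) else 0 := by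
  obtain ⟨j, m, hm, rfl⟩ := Nat.exists_eq_pow_mul_and_not_dvd hn p hp.ne_one
  have hc : ∀ i, (p ^ i).Coprime m := fun i =>
    Nat.Coprime.pow_left i ((Nat.Prime.coprime_iff_not_dvd hp).2 hm)
  rw [← mul_assoc, ← pow_succ', eulerCoeff_mul α β (hc _), eulerCoeff_mul α β (hc _),
    eulerCoeff_prime_pow α β hp, eulerCoeff_prime_pow α β hp]
  rcases j with _ | j
  · simp [hm, quadCoeff]
  · rw [if_pos (Dvd.dvd.mul_right (dvd_pow_self p j.succ_ne_zero) m),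
      show p ^ (j + 1) * m / p = p ^ j * m by
        rw [pow_succ', mul_assoc, Nat.mul_div_cancel_left _ hp.pos],
      eulerCoeff_mul α β (hc _), eulerCoeff_prime_pow α β hp, quadCoeff]
    ring

lemma hasProd_eulerCoeff {B : ℕ} (hα : ∀ p : ℕ, p.Prime → ‖α p‖ ≤ (p : ℝ) ^ B / 2)
    (hβ : ∀ p : ℕ, p.Prime → ‖β p‖ ≤ ((p : ℝ) ^ B) ^ 2 / 2) {s : ℂ} (hs : (B : ℝ) + 1 < s.re) :
    HasProd (fun p : Nat.Primes =>
      (1 - α p * ((p : ℕ) : ℂ) ^ (-s) + β p * (((p : ℕ) : ℂ) ^ (-s)) ^ 2)⁻¹)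
      (LSeries (eulerCoeff α β) s) := by
  have hsum : LSeriesSummable (eulerCoeff α β) s := by
    refine LSeriesSummable_of_le_const_mul_rpow hs ⟨1, fun n hn => ?_⟩
    simpa using norm_eulerCoeff_le α β hα hβ n
  have hterm : ∀ n, LSeries.term (eulerCoeff α β) s n = eulerCoeff α β n * (n : ℂ) ^ (-s) := by
    intro n
    rcases eq_or_ne n 0 with rfl | hn
    · simp [eulerCoeff]
    · rw [LSeries.term_of_ne_zero hn, cpow_neg, div_eq_mul_inv]
  have h := EulerProduct.eulerProduct_hasProd (f := LSeries.term (eulerCoeff α β) s)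
    (by simp [eulerCoeff_one])
    (by
      intro m n hmn
      simp only [hterm, eulerCoeff_mul α β hmn, Nat.cast_mul, natCast_mul_natCast_cpow]
      ring) hsum.norm (LSeries.term_zero _ _)
  convert! h using 2 with p
  have hp := p.prop
  have hp1 : (1 : ℝ) < (p : ℕ) := by exact_mod_cast hp.one_lt
  have hx : (p : ℝ) ^ B * ‖((p : ℕ) : ℂ) ^ (-s)‖ < 1 := by
    rw [Complex.norm_natCast_cpow_of_pos hp.pos, ← Real.rpow_natCast, ← Real.rpow_add (by linarith)]
    apply Real.rpow_lt_one_of_one_lt_of_neg hp1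
    rw [neg_re]
    linarith
  rw [← (hasSum_quadCoeff (hα p hp) (hβ p hp) hx).tsum_eq]
  refine tsum_congr fun e => ?_
  rw [hterm, eulerCoeff_prime_pow α β hp, Nat.cast_pow, ← natCast_cpow_natCast_mul, ← cpow_nat_mul]

end eulerCoeff

lemma LSeries_eq_of_hasSum {a : ℕ → ℂ} {s l : ℂ}
    (h : HasSum (fun n : ℕ => a (n + 1) * ((n + 1 : ℕ) : ℂ) ^ (-s)) l) : LSeries a s = l := by
  have : HasSum (LSeries.term a s) l := by
    rw [← hasSum_nat_add_iff' 1]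
    simp only [Finset.range_one, Finset.sum_singleton, LSeries.term_zero, sub_zero]
    convert! h using 2 with n
    rw [LSeries.term_of_ne_zero n.succ_ne_zero, cpow_neg, div_eq_mul_inv]
  exact this.tsum_eq

/-- The coefficients of a Dirichlet series with a quadratic Euler product satisfy the Hecke
recursion at every prime. -/
theorem coeff_prime_mul_of_eulerProduct {a α β : ℕ → ℂ} {σ : ℝ} {A : ℕ}
    (hbound : ∃ M : ℝ, ∀ n : ℕ, 1 ≤ n → ‖a n‖ ≤ M * (n : ℝ) ^ σ)
    {L : ℂ → ℂ} (hL : ∀ s : ℂ, σ + 1 < s.re →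
      HasSum (fun n : ℕ => a (n + 1) * ((n + 1 : ℕ) : ℂ) ^ (-s)) (L s))
    (heuler : ∀ s : ℂ, σ + 1 < s.re → L s = ∏' p : Nat.Primes,
      (1 - α p * ((p : ℕ) : ℂ) ^ (-s) + β p * (((p : ℕ) : ℂ) ^ (-s)) ^ 2)⁻¹)
    (hα : ∀ p : ℕ, p.Prime → ‖α p‖ ≤ ‖a p‖ ∨ ‖α p‖ ≤ (p : ℝ) ^ A)
    (hβ : ∀ p : ℕ, p.Prime → ‖β p‖ ≤ (p : ℝ) ^ A)
    {p : ℕ} (hp : p.Prime) {n : ℕ} (hn : n ≠ 0) :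
    a (p * n) = α p * a n - if p ∣ n then β p * a (n / p) else 0 := by
  obtain ⟨M, hM⟩ := hbound
  obtain ⟨B₁, hB₁⟩ := pow_unbounded_of_one_lt (2 * M) (one_lt_two)
  obtain ⟨B₂, hB₂⟩ := exists_nat_gt σ
  set B := B₁ + B₂ + A + 1 with hB
  have hαB : ∀ p : ℕ, p.Prime → ‖α p‖ ≤ (p : ℝ) ^ B / 2 := by
    intro p hp
    have hp2 : (2 : ℝ) ≤ p := by exact_mod_cast hp.two_le
    have hp1 : (1 : ℝ) ≤ p := by linarith
    rcases hα p hp with h | h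
    · have h1 : 2 * M ≤ (p : ℝ) ^ B₁ := hB₁.le.trans (by gcongr)
      have h2 : (p : ℝ) ^ σ ≤ (p : ℝ) ^ B₂ := by
        rw [← Real.rpow_natCast]; exact Real.rpow_le_rpow_of_exponent_le hp1 hB₂.le
      have h3 : 2 * M * (p : ℝ) ^ σ ≤ (p : ℝ) ^ B₁ * (p : ℝ) ^ B₂ := by gcongr
      have h4 : (p : ℝ) ^ B₁ * (p : ℝ) ^ B₂ ≤ (p : ℝ) ^ B := by
        rw [← pow_add]; exact pow_le_pow_right₀ hp1 (by omega)
      linarith [hM p hp.one_lt.le]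
    · have h5 : (p : ℝ) ^ A * 2 ≤ (p : ℝ) ^ A * p := by gcongr
      have h6 : (p : ℝ) ^ A * p ≤ (p : ℝ) ^ B := by
        rw [← pow_succ]; exact pow_le_pow_right₀ hp1 (by omega)
      linarith
  have hβB : ∀ p : ℕ, p.Prime → ‖β p‖ ≤ ((p : ℝ) ^ B) ^ 2 / 2 := by
    intro p hp
    have hp2 : (2 : ℝ) ≤ p := by exact_mod_cast hp.two_le
    have hp1 : (1 : ℝ) ≤ p := by linarith
    have h5 : (p : ℝ) ^ A * 2 ≤ (p : ℝ) ^ A * p := by gcongr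
    have h6 : (p : ℝ) ^ A * p ≤ ((p : ℝ) ^ B) ^ 2 := by
      rw [← pow_succ, ← pow_mul]; exact pow_le_pow_right₀ hp1 (by omega)
    linarith [hβ p hp]
  have hab : ∀ n : ℕ, n ≠ 0 → a n = eulerCoeff α β n := by
    intro n hn
    refine LSeries.eq_of_LSeries_eventually_eq
      ((LSeries.abscissaOfAbsConv_le_of_le_const_mul_rpow (x := σ)
        ⟨M, fun n hn => hM n (Nat.one_le_iff_ne_zero.2 hn)⟩).trans_lt (EReal.coe_lt_top (σ + 1)))
      ((LSeries.abscissaOfAbsConv_le_of_le_const_mul_rpow (x := B)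
        ⟨1, fun n _ => by simpa using norm_eulerCoeff_le α β hαB hβB n⟩).trans_lt
          (EReal.coe_lt_top (B + 1))) ?_ hn
    filter_upwards [Filter.eventually_gt_atTop ((B : ℝ) + 1), Filter.eventually_gt_atTop (σ + 1)]
      with x hx1 hx2
    rw [LSeries_eq_of_hasSum (hL x (by simpa using hx2)), heuler x (by simpa using hx2)]
    exact (hasProd_eulerCoeff α β hαB hβB (by simpa using hx1)).tprod_eq
  rw [hab _ (mul_ne_zero hp.ne_zero hn), hab n hn, eulerCoeff_prime_mul α β hp hn]
  split_ifs with h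
  · rw [hab (n / p) (Nat.div_pos (Nat.le_of_dvd (Nat.pos_of_ne_zero hn) h) hp.pos).ne']
  · rfl

/-- The sum `∑ a n * exp (2πinz)` over `n ≥ 1`. -/
noncomputable def qSeries (a : ℕ → ℂ) (z : ℂ) : ℂ :=
  ∑' n : ℕ, a (n + 1) * cexp (2 * (Real.pi : ℂ) * Complex.I * ((n + 1 : ℕ) : ℂ) * z)

section qSeries

variable {a : ℕ → ℂ} {M : ℝ} {A : ℕ}

lemma norm_qSeries_term (n : ℕ) (z : ℂ) :
    ‖a (n + 1) * cexp (2 * (Real.pi : ℂ) * Complex.I * ((n + 1 : ℕ) : ℂ) * z)‖ =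
      ‖a (n + 1)‖ * Real.exp (-(2 * Real.pi * (n + 1) * z.im)) := by
  rw [norm_mul, Complex.norm_exp]
  congr 2
  simp [mul_assoc]

lemma norm_qSeries_term_le (ha : ∀ n : ℕ, 1 ≤ n → ‖a n‖ ≤ M * (n : ℝ) ^ A) (B n : ℕ) {z : ℂ}
    {y : ℝ} (hy : 0 < y) (hz : y ≤ z.im) :
    ‖a (n + 1) * cexp (2 * (Real.pi : ℂ) * Complex.I * ((n + 1 : ℕ) : ℂ) * z)‖ ≤
      M * (A + 2 + B).factorial * (y ^ (A + 2 + B))⁻¹ * (((n + 1 : ℕ) : ℝ) ^ 2)⁻¹ := by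
  rw [norm_qSeries_term]
  have hM : 0 ≤ M := by simpa using (norm_nonneg _).trans (ha 1 le_rfl)
  have hn : (1 : ℝ) ≤ n + 1 := by simp
  have h1 := ha (n + 1) (by omega)
  push_cast at h1 ⊢
  set x : ℝ := (n : ℝ) + 1
  have hxy : 0 < x * y := by positivity
  have h2 := Real.pow_div_factorial_le_exp (x * y) hxy.le (A + 2 + B)
  have h3 : Real.exp (-(2 * Real.pi * x * z.im)) ≤ (Real.exp (x * y))⁻¹ := by
    rw [← Real.exp_neg]
    apply Real.exp_le_exp.2
    have : x * y ≤ x * z.im := by gcongr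
    nlinarith [Real.pi_gt_three]
  have h4 : (Real.exp (x * y))⁻¹ ≤ ((x * y) ^ (A + 2 + B) / (A + 2 + B).factorial)⁻¹ := by
    gcongr
  have h5 : (1 : ℝ) ≤ x ^ B := one_le_pow₀ hn
  calc ‖a (n + 1)‖ * Real.exp (-(2 * Real.pi * x * z.im))
      ≤ (M * x ^ A * x ^ B) * ((x * y) ^ (A + 2 + B) / (A + 2 + B).factorial)⁻¹ := by
        apply mul_le_mul (h1.trans ?_) (h3.trans h4) (Real.exp_pos _).le (by positivity)
        exact le_mul_of_one_le_right (by positivity) h5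
    _ = _ := by
        have : x ≠ 0 := by positivity
        field_simp
        rw [mul_pow]
        ring

lemma summable_inv_sq_succ : Summable fun n : ℕ => (((n + 1 : ℕ) : ℝ) ^ 2)⁻¹ :=
  (summable_nat_add_iff (f := fun n : ℕ => ((n : ℝ) ^ 2)⁻¹) 1).2
    (Real.summable_nat_pow_inv.2 one_lt_two)

lemma summable_qSeries (ha : ∀ n : ℕ, 1 ≤ n → ‖a n‖ ≤ M * (n : ℝ) ^ A) {z : ℂ} (hz : 0 < z.im) :
    Summable fun n : ℕ => a (n + 1) * cexp (2 * (Real.pi : ℂ) * Complex.I * ((n + 1 : ℕ) : ℂ) * z) :=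
  .of_norm_bounded (summable_inv_sq_succ.mul_left _)
    fun n => norm_qSeries_term_le ha 0 n hz le_rfl

lemma differentiableOn_qSeries (ha : ∀ n : ℕ, 1 ≤ n → ‖a n‖ ≤ M * (n : ℝ) ^ A) :
    DifferentiableOn ℂ (qSeries a) {z | 0 < z.im} := by
  intro z hz
  have hz' : 0 < z.im := hz
  have hopen : IsOpen {w : ℂ | z.im / 2 < w.im} := isOpen_lt continuous_const continuous_im
  have h := differentiableOn_tsum_of_summable_norm (U := {w : ℂ | z.im / 2 < w.im})
    (F := fun (n : ℕ) w => a (n + 1) * cexp (2 * (Real.pi : ℂ) * Complex.I * ((n + 1 : ℕ) : ℂ) * w))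
    (summable_inv_sq_succ.mul_left _) (fun n => by fun_prop) hopen
    (fun n w hw => norm_qSeries_term_le ha 0 n (half_pos hz') (le_of_lt hw))
  exact (h.differentiableAt (hopen.mem_nhds (by simp [hz']))).differentiableWithinAt

lemma exists_norm_qSeries_le (ha : ∀ n : ℕ, 1 ≤ n → ‖a n‖ ≤ M * (n : ℝ) ^ A) (B : ℕ) :
    ∃ C : ℝ, 0 ≤ C ∧ ∀ z : ℂ, 0 < z.im → ‖qSeries a z‖ ≤ C * (z.im ^ (A + 2 + B))⁻¹ := by
  have hM : 0 ≤ M := by simpa using (norm_nonneg _).trans (ha 1 le_rfl)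
  refine ⟨M * (A + 2 + B).factorial * ∑' n : ℕ, (((n + 1 : ℕ) : ℝ) ^ 2)⁻¹, by positivity,
    fun z hz => ?_⟩
  refine (tsum_of_norm_bounded ((summable_inv_sq_succ.mul_left _).hasSum)
    fun n => norm_qSeries_term_le ha B n hz le_rfl).trans (le_of_eq ?_)
  rw [tsum_mul_left]
  ring

end qSeries

section
open MeasureTheory Filter Topology

lemma norm_exp_mul_sq (ε x t : ℝ) :
    ‖cexp (ε * ((x : ℂ) + t * Complex.I) ^ 2)‖ = Real.exp (ε * (x ^ 2 - t ^ 2)) := by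
  rw [Complex.norm_exp]
  congr 1
  simp [pow_two]

/-- Integrals of a bounded entire function over two vertical lines agree when both converge. -/
lemma integral_vertical_line_eq {G : ℂ → ℂ} (hG : Differentiable ℂ G) {c d C : ℝ} (hcd : c ≤ d)
    (hC : ∀ s : ℂ, c ≤ s.re → s.re ≤ d → ‖G s‖ ≤ C)
    (hc : Integrable fun t : ℝ => G (c + t * Complex.I))
    (hd : Integrable fun t : ℝ => G (d + t * Complex.I)) :
    ∫ t : ℝ, G (c + t * Complex.I) = ∫ t : ℝ, G (d + t * Complex.I) := by
  have hC0 : 0 ≤ C := (norm_nonneg _).trans (hC c (by simp) (by simpa using hcd))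
  have hdom (x : ℝ) (ε : ℝ) (hε : 0 < ε) (hε1 : ε ≤ 1) (t : ℝ) :
      ‖G (x + t * Complex.I) * cexp (ε * ((x : ℂ) + t * Complex.I) ^ 2)‖ ≤
        Real.exp (x ^ 2) * ‖G (x + t * Complex.I)‖ := by
    rw [norm_mul, norm_exp_mul_sq, mul_comm]
    gcongr
    nlinarith [sq_nonneg t, sq_nonneg x, mul_nonneg hε.le (sq_nonneg t)]
  have hcont (x ε : ℝ) : Continuous fun t : ℝ =>
      G (x + t * Complex.I) * cexp (ε * ((x : ℂ) + t * Complex.I) ^ 2) := by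
    have := hG.continuous
    fun_prop
  have hint (x : ℝ) (hx : Integrable fun t : ℝ => G (x + t * Complex.I)) (ε : ℝ) (hε : 0 < ε)
      (hε1 : ε ≤ 1) : Integrable fun t : ℝ =>
        G (x + t * Complex.I) * cexp (ε * ((x : ℂ) + t * Complex.I) ^ 2) :=
    (hx.norm.const_mul (Real.exp (x ^ 2))).mono' (hcont x ε).aestronglyMeasurable
      (Eventually.of_forall (hdom x ε hε hε1))
  have key (ε : ℝ) (hε : 0 < ε) (hε1 : ε ≤ 1) :
      ∫ t : ℝ, G (c + t * Complex.I) * cexp (ε * ((c : ℂ) + t * Complex.I) ^ 2) =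
        ∫ t : ℝ, G (d + t * Complex.I) * cexp (ε * ((d : ℂ) + t * Complex.I) ^ 2) := by
    set H : ℂ → ℂ := fun s => G s * cexp (ε * s ^ 2) with hH
    have hHd : Differentiable ℂ H := by
      rw [hH]; fun_prop
    have hHb (x t : ℝ) (hx1 : c ≤ x) (hx2 : x ≤ d) :
        ‖H (x + t * Complex.I)‖ ≤ C * Real.exp (c ^ 2 + d ^ 2) * Real.exp (-(ε * t ^ 2)) := by
      rw [hH]
      simp only
      rw [norm_mul, norm_exp_mul_sq, mul_assoc, ← Real.exp_add]
      have hx : x ^ 2 ≤ c ^ 2 + d ^ 2 := by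
        rcases le_total 0 x with h | h <;> nlinarith
      gcongr
      · exact hC _ (by simpa using hx1) (by simpa using hx2)
      · nlinarith [sq_nonneg x]
    have hlim (x : ℝ) (hx : Integrable fun t : ℝ => G (x + t * Complex.I)) :
        Tendsto (fun T : ℝ => ∫ t in -T..T, H (x + t * Complex.I)) atTop
          (𝓝 (∫ t : ℝ, H (x + t * Complex.I))) :=
      intervalIntegral_tendsto_integral (hint x hx ε hε hε1) tendsto_neg_atTop_atBot tendsto_id
    have hzero : Tendsto (fun T : ℝ => (∫ t in -T..T, H (d + t * Complex.I)) -
        ∫ t in -T..T, H (c + t * Complex.I)) atTop (𝓝 0) := by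
      have hb : Tendsto (fun T : ℝ => 2 * (C * Real.exp (c ^ 2 + d ^ 2) *
          Real.exp (-(ε * T ^ 2)) * |d - c|)) atTop (𝓝 0) := by
        have : Tendsto (fun T : ℝ => Real.exp (-(ε * T ^ 2))) atTop (𝓝 0) :=
          Real.tendsto_exp_neg_atTop_nhds_zero.comp
            ((tendsto_pow_atTop two_ne_zero).const_mul_atTop hε)
        simpa using ((this.const_mul (C * Real.exp (c ^ 2 + d ^ 2))).mul_const |d - c|).const_mul 2
      refine squeeze_zero_norm (fun T => ?_) hb
      have h := integral_boundary_rect_eq_zero_of_differentiableOn H (c + (-T : ℝ) * Complex.I)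
        (d + (T : ℝ) * Complex.I) hHd.differentiableOn
      simp only [add_re, ofReal_re, mul_re, Complex.I_re, mul_zero, ofReal_im, Complex.I_im,
        mul_one, sub_self, add_zero, add_im, mul_im, zero_add, smul_eq_mul] at h
      have hI1 (t : ℝ) : ‖∫ x in c..d, H (x + t * Complex.I)‖ ≤
          C * Real.exp (c ^ 2 + d ^ 2) * Real.exp (-(ε * t ^ 2)) * |d - c| := by
        apply intervalIntegral.norm_integral_le_of_norm_le_const
        intro x hx
        rw [Set.uIoc_of_le hcd] at hx
        exact hHb x t hx.1.le hx.2
      have h2 : (∫ t in -T..T, H (d + t * Complex.I)) - ∫ t in -T..T, H (c + t * Complex.I) =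
          Complex.I * ((∫ x in c..d, H (x + (-T : ℝ) * Complex.I)) -
            ∫ x in c..d, H (x + (T : ℝ) * Complex.I)) := by
        linear_combination (-Complex.I) * h + ((∫ t in -T..T, H (d + t * Complex.I)) -
          ∫ t in -T..T, H (c + t * Complex.I)) * Complex.I_sq
      rw [h2, norm_mul, Complex.norm_I, one_mul]
      refine (norm_sub_le _ _).trans ?_
      have e1 := hI1 (-T)
      have e2 := hI1 T
      rw [neg_sq] at e1
      linarith
    exact (sub_eq_zero.1 (tendsto_nhds_unique ((hlim d hd).sub (hlim c hc)) hzero)).symm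
  have hu : Tendsto (fun n : ℕ => (1 : ℝ) / (n + 1)) atTop (𝓝 0) :=
    tendsto_one_div_add_atTop_nhds_zero_nat
  have hu0 (n : ℕ) : 0 < (1 : ℝ) / (n + 1) := by positivity
  have hu1 (n : ℕ) : (1 : ℝ) / (n + 1) ≤ 1 := by
    rw [div_le_one (by positivity)]; simp
  have lim (x : ℝ) (hx : Integrable fun t : ℝ => G (x + t * Complex.I)) :
      Tendsto (fun n : ℕ => ∫ t : ℝ, G (x + t * Complex.I) *
        cexp (((1 / (n + 1) : ℝ) : ℂ) * ((x : ℂ) + t * Complex.I) ^ 2)) atTop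
        (𝓝 (∫ t : ℝ, G (x + t * Complex.I))) := by
    apply tendsto_integral_of_dominated_convergence
      (fun t : ℝ => Real.exp (x ^ 2) * ‖G (x + t * Complex.I)‖)
    · exact fun n => (hcont x _).aestronglyMeasurable
    · exact hx.norm.const_mul _
    · exact fun n => Eventually.of_forall (hdom x _ (hu0 n) (hu1 n))
    · refine Eventually.of_forall fun t => ?_
      have h1 : Tendsto (fun n : ℕ => ((1 / (n + 1) : ℝ) : ℂ)) atTop (𝓝 ((0 : ℝ) : ℂ)) :=
        (continuous_ofReal.tendsto 0).comp hu
      have h2 : Continuous fun w : ℂ =>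
        G (x + t * Complex.I) * cexp (w * ((x : ℂ) + t * Complex.I) ^ 2) := by fun_prop
      have h3 := (h2.tendsto _).comp h1
      simp only [ofReal_zero, zero_mul, Complex.exp_zero, mul_one] at h3
      exact h3
  refine tendsto_nhds_unique (lim c hc) ?_
  simp_rw [fun n : ℕ => key _ (hu0 n) (hu1 n)]
  exact lim d hd

lemma norm_Gamma_le_Gamma_re {s : ℂ} (hs : 0 < s.re) : ‖Complex.Gamma s‖ ≤ Real.Gamma s.re := by
  rw [Complex.Gamma_eq_integral hs, Real.Gamma_eq_integral hs, Complex.GammaIntegral]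
  refine (norm_integral_le_integral_norm _).trans (le_of_eq ?_)
  refine setIntegral_congr_fun measurableSet_Ioi fun x hx => ?_
  rw [norm_mul, Complex.norm_of_nonneg (Real.exp_pos _).le, norm_cpow_eq_rpow_re_of_pos hx]
  simp

lemma norm_Gamma_vertical_le {c : ℝ} (hc : 1 ≤ c) (t : ℝ) :
    ‖Complex.Gamma (c + t * Complex.I)‖ ≤ Real.Gamma (c + 2) * (1 + t ^ 2)⁻¹ := by
  set s : ℂ := c + t * Complex.I with hs
  have hre : s.re = c := by simp [hs]
  have him : s.im = t := by simp [hs]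
  have hs0 : s ≠ 0 := fun h => by rw [h] at hre; simp at hre; linarith
  have hs1 : s + 1 ≠ 0 := fun h => by
    have := congrArg Complex.re h
    simp [hre] at this; linarith
  have h1 : Complex.Gamma (s + 2) = (s + 1) * (s * Complex.Gamma s) := by
    rw [← Complex.Gamma_add_one s hs0, ← Complex.Gamma_add_one (s + 1) hs1]
    congr 1; ring
  have h2 : ‖Complex.Gamma (s + 2)‖ ≤ Real.Gamma (c + 2) := by
    have := norm_Gamma_le_Gamma_re (s := s + 2) (by simp [hre]; linarith)
    simpa [hre] using this
  have h3 : 1 + t ^ 2 ≤ ‖s + 1‖ * ‖s‖ := by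
    have e1 : 1 + t ^ 2 ≤ ‖s‖ ^ 2 := by
      rw [← Complex.normSq_eq_norm_sq, Complex.normSq_apply, hre, him]; nlinarith
    have e2 : ‖s‖ ^ 2 ≤ ‖s + 1‖ ^ 2 := by
      rw [← Complex.normSq_eq_norm_sq, ← Complex.normSq_eq_norm_sq, Complex.normSq_apply,
        Complex.normSq_apply]
      simp [hre, him]; nlinarith
    have e3 : ‖s‖ ≤ ‖s + 1‖ := by
      exact (pow_le_pow_iff_left₀ (norm_nonneg _) (norm_nonneg _) two_ne_zero).1 e2
    nlinarith [norm_nonneg s]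
  rw [h1, norm_mul, norm_mul, ← mul_assoc] at h2
  rw [← div_eq_mul_inv, le_div_iff₀ (by positivity), mul_comm]
  exact (mul_le_mul_of_nonneg_right h3 (norm_nonneg _)).trans h2

variable {a : ℕ → ℂ} {M : ℝ} {A : ℕ}

lemma mellinConvergent_qSeries (ha : ∀ n : ℕ, 1 ≤ n → ‖a n‖ ≤ M * (n : ℝ) ^ A) {s : ℂ}
    (hs : (A : ℝ) + 2 < s.re) :
    MellinConvergent (fun y : ℝ => qSeries a (y * Complex.I)) s := by
  have hcont : ContinuousOn (fun y : ℝ => qSeries a (y * Complex.I)) (Set.Ioi 0) := by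
    refine (differentiableOn_qSeries ha).continuousOn.comp (by fun_prop) fun y hy => ?_
    simpa using hy
  obtain ⟨B, hB⟩ := exists_nat_gt s.re
  have hO (B : ℕ) (l : Filter ℝ) (hl : ∀ᶠ y in l, 0 < y) :
      (fun y : ℝ => qSeries a (y * Complex.I)) =O[l] fun y => y ^ (-((A + 2 + B : ℕ) : ℝ)) := by
    obtain ⟨C, -, hC⟩ := exists_norm_qSeries_le ha B
    refine Asymptotics.IsBigO.of_bound C ?_
    filter_upwards [hl] with y hy
    have := hC (y * Complex.I) (by simpa using hy)
    rw [show ((y : ℂ) * Complex.I).im = y by simp] at this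
    rwa [Real.rpow_neg hy.le, Real.rpow_natCast, Real.norm_of_nonneg (by positivity)]
  refine mellinConvergent_of_isBigO_rpow (hcont.locallyIntegrableOn measurableSet_Ioi)
    (hO B atTop (eventually_gt_atTop 0)) ?_ (hO 0 _ self_mem_nhdsWithin) ?_
  · push_cast
    linarith [(Nat.cast_nonneg A : (0 : ℝ) ≤ A)]
  · push_cast
    linarith

lemma mellin_qSeries (ha : ∀ n : ℕ, 1 ≤ n → ‖a n‖ ≤ M * (n : ℝ) ^ A) {s l : ℂ}
    (hs : (A : ℝ) + 2 < s.re)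
    (hl : HasSum (fun n : ℕ => a (n + 1) * ((n + 1 : ℕ) : ℂ) ^ (-s)) l) :
    mellin (fun y : ℝ => qSeries a (y * Complex.I)) s =
      (2 * (Real.pi : ℂ)) ^ (-s) * Complex.Gamma s * l := by
  have hA : (0 : ℝ) ≤ A := Nat.cast_nonneg A
  have h := hasSum_mellin (a := fun n : ℕ => a (n + 1)) (p := fun n => 2 * Real.pi * (n + 1))
    (F := fun y : ℝ => qSeries a (y * Complex.I)) (s := s)
    (fun n => Or.inr (by positivity)) (by linarith) (fun t ht => by
      convert! (summable_qSeries ha (z := t * Complex.I) (by simpa using ht)).hasSum using 3 with n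
      rw [Complex.ofReal_exp]
      congr 1
      push_cast
      linear_combination (-2 * (Real.pi : ℂ) * (n + 1) * t) * Complex.I_sq) (by
      have hM : 0 ≤ M := by simpa using (norm_nonneg _).trans (ha 1 le_rfl)
      refine .of_nonneg_of_le (fun n => by positivity) (fun n => ?_)
        (summable_inv_sq_succ.mul_left M)
      have hn : (1 : ℝ) ≤ n + 1 := by simp
      have h1 := ha (n + 1) (by omega)
      rw [div_le_iff₀ (by positivity)]
      push_cast at h1 ⊢
      refine h1.trans ?_
      have h2 : ((n : ℝ) + 1) ^ (A + 2) ≤ (2 * Real.pi * (n + 1)) ^ s.re := by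
        rw [← Real.rpow_natCast]
        calc ((n : ℝ) + 1) ^ ((A + 2 : ℕ) : ℝ) ≤ (n + 1) ^ s.re := by
              apply Real.rpow_le_rpow_of_exponent_le hn
              push_cast; linarith
          _ ≤ _ := by
              apply Real.rpow_le_rpow (by positivity) _ (by linarith)
              nlinarith [Real.pi_gt_three]
      calc M * ((n : ℝ) + 1) ^ A = M * (((n : ℝ) + 1) ^ 2)⁻¹ * (n + 1) ^ (A + 2) := by
            field_simp
            ring
        _ ≤ _ := by gcongr)
  refine h.unique ?_
  convert! hl.mul_left ((2 * (Real.pi : ℂ)) ^ (-s) * Complex.Gamma s) using 2 with n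
  have e : ((2 * Real.pi * ((n : ℝ) + 1) : ℝ) : ℂ) =
      ((2 * Real.pi : ℝ) : ℂ) * ((n + 1 : ℝ) : ℂ) := by push_cast; ring
  rw [e, Complex.mul_cpow_ofReal_nonneg (by positivity) (by positivity), Complex.cpow_neg,
    Complex.cpow_neg]
  push_cast
  field_simp

lemma norm_le_of_hasSum_cpow (ha : ∀ n : ℕ, 1 ≤ n → ‖a n‖ ≤ M * (n : ℝ) ^ A) {s l : ℂ}
    (hs : (A : ℝ) + 2 < s.re)
    (hl : HasSum (fun n : ℕ => a (n + 1) * ((n + 1 : ℕ) : ℂ) ^ (-s)) l) :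
    ‖l‖ ≤ M * ∑' n : ℕ, (((n + 1 : ℕ) : ℝ) ^ 2)⁻¹ := by
  have hM : 0 ≤ M := by simpa using (norm_nonneg _).trans (ha 1 le_rfl)
  rw [← tsum_mul_left, ← hl.tsum_eq]
  refine tsum_of_norm_bounded (summable_inv_sq_succ.mul_left M).hasSum fun n => ?_
  have hn : (1 : ℝ) ≤ n + 1 := by simp
  have h1 := ha (n + 1) (by omega)
  rw [norm_mul, Complex.norm_natCast_cpow_of_pos (by omega)]
  push_cast at h1 ⊢
  calc ‖a (n + 1)‖ * ((n : ℝ) + 1) ^ (-s).re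
      ≤ M * ((n : ℝ) + 1) ^ A * ((n : ℝ) + 1) ^ (-((A + 2 : ℕ) : ℝ)) := by
        gcongr
        push_cast
        simp only [neg_re]
        linarith
    _ = _ := by
        rw [Real.rpow_neg (by positivity), Real.rpow_natCast]
        field_simp
        ring

/-- Hecke's converse theorem on the imaginary axis. -/
lemma qSeries_imaginary_axis (ha : ∀ n : ℕ, 1 ≤ n → ‖a n‖ ≤ M * (n : ℝ) ^ A) {c₀ : ℝ} {L Λ : ℂ → ℂ}
    (hL : ∀ s : ℂ, c₀ < s.re →
      HasSum (fun n : ℕ => a (n + 1) * ((n + 1 : ℕ) : ℂ) ^ (-s)) (L s))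
    (hΛ : ∀ s : ℂ, c₀ < s.re → Λ s = (2 * (Real.pi : ℂ)) ^ (-s) * Complex.Gamma s * L s)
    (hΛdiff : Differentiable ℂ Λ)
    (hΛbdd : ∀ A B : ℝ, ∃ C : ℝ, ∀ s : ℂ, A ≤ s.re → s.re ≤ B → ‖Λ s‖ ≤ C)
    {m N : ℕ} (hN : 0 < N)
    (hFE : ∀ s : ℂ, Λ s = (-1 : ℂ) ^ m * (N : ℂ) ^ ((m : ℂ) - s) * Λ (2 * m - s)) {x : ℝ}
    (hx : 0 < x) :
    qSeries a (x * Complex.I) =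
      (-1) ^ m * ((N : ℂ) ^ m)⁻¹ * ((x : ℂ) ^ (2 * m))⁻¹ *
        qSeries a (((N * x : ℝ)⁻¹ : ℝ) * Complex.I) := by
  have hA : (0 : ℝ) ≤ A := Nat.cast_nonneg A
  set c : ℝ := max c₀ (A + 2) + 1 + m with hc
  have hm : (0 : ℝ) ≤ m := Nat.cast_nonneg m
  have hc1 : c₀ < c := by linarith [le_max_left c₀ ((A : ℝ) + 2)]
  have hc2 : (A : ℝ) + 2 < c := by linarith [le_max_right c₀ ((A : ℝ) + 2)]
  have hc3 : (m : ℝ) ≤ c := by linarith [le_max_right c₀ ((A : ℝ) + 2)]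
  set φ : ℝ → ℂ := fun y => qSeries a (y * Complex.I) with hφ
  have hφc {y : ℝ} (hy : 0 < y) : ContinuousAt φ y := by
    have h1 : ContinuousAt (qSeries a) (y * Complex.I) :=
      ((differentiableOn_qSeries ha).differentiableAt ((isOpen_lt continuous_const
        Complex.continuous_im).mem_nhds (by simpa using hy))).continuousAt
    exact ContinuousAt.comp (f := fun y : ℝ => (y : ℂ) * Complex.I) h1 (by fun_prop)
  have hre (t : ℝ) : ((c : ℂ) + t * Complex.I).re = c := by simp
  have hmel (t : ℝ) : mellin φ (c + t * Complex.I) = Λ (c + t * Complex.I) := by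
    rw [hΛ _ (by rw [hre]; exact hc1)]
    exact mellin_qSeries ha (by rw [hre]; exact hc2) (hL _ (by rw [hre]; exact hc1))
  have hΛc : Continuous Λ := hΛdiff.continuous
  have hint : Integrable fun t : ℝ => Λ (c + t * Complex.I) := by
    refine (integrable_inv_one_add_sq.const_mul ((2 * Real.pi) ^ (-c) * Real.Gamma (c + 2) *
      (M * ∑' n : ℕ, (((n + 1 : ℕ) : ℝ) ^ 2)⁻¹))).mono'
      (by exact (show Continuous fun t : ℝ => Λ (c + t * Complex.I) by
        fun_prop).aestronglyMeasurable) (Eventually.of_forall fun t => ?_)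
    rw [hΛ _ (by rw [hre]; exact hc1), norm_mul, norm_mul]
    have e1 : ‖(2 * (Real.pi : ℂ)) ^ (-((c : ℂ) + t * Complex.I))‖ = (2 * Real.pi) ^ (-c) := by
      rw [show (2 * (Real.pi : ℂ)) = ((2 * Real.pi : ℝ) : ℂ) by push_cast; rfl,
        Complex.norm_cpow_eq_rpow_re_of_pos (by positivity)]
      simp
    have e2 := norm_Gamma_vertical_le (c := c) (by linarith) t
    have e3 := norm_le_of_hasSum_cpow ha (by rw [hre]; exact hc2)
      (hL (c + t * Complex.I) (by rw [hre]; exact hc1))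
    rw [e1]
    calc _ ≤ (2 * Real.pi) ^ (-c) * (Real.Gamma (c + 2) * (1 + t ^ 2)⁻¹) *
        (M * ∑' n : ℕ, (((n + 1 : ℕ) : ℝ) ^ 2)⁻¹) := by gcongr
      _ = _ := by ring
  have hinv {y : ℝ} (hy : 0 < y) : φ y =
      (1 / (2 * Real.pi)) • ∫ t : ℝ, (y : ℂ) ^ (-((c : ℂ) + t * Complex.I)) *
        Λ (c + t * Complex.I) := by
    rw [← mellinInv_mellin_eq c φ hy (mellinConvergent_qSeries ha (by simpa using hc2)) (by
      rw [VerticalIntegrable]; simpa only [hmel] using hint) (hφc hy), mellinInv]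
    simp only [hmel, smul_eq_mul]
  set G : ℂ → ℂ := fun s => (x : ℂ) ^ (-s) * Λ s with hG
  have hx0 : (x : ℂ) ≠ 0 := by exact_mod_cast hx.ne'
  have hN0 : (N : ℂ) ≠ 0 := by exact_mod_cast hN.ne'
  have hGd : Differentiable ℂ G := by
    intro s
    have : DifferentiableAt ℂ (fun s : ℂ => (x : ℂ) ^ (-s)) s :=
      (differentiableAt_id.neg).const_cpow (Or.inl hx0)
    exact this.mul (hΛdiff s)
  have hGint' {y : ℝ} (hy : 0 < y) : Integrable fun t : ℝ =>
      (y : ℂ) ^ (-((c : ℂ) + t * Complex.I)) * Λ (c + t * Complex.I) := by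
    have hy0 : (y : ℂ) ≠ 0 := by exact_mod_cast hy.ne'
    refine (hint.norm.const_mul (y ^ (-c))).mono' ?_ (Eventually.of_forall fun t => ?_)
    · refine Continuous.aestronglyMeasurable (.mul (.const_cpow (by fun_prop) (Or.inl hy0)) ?_)
      fun_prop
    · rw [norm_mul, Complex.norm_cpow_eq_rpow_re_of_pos hy]
      simp
  set y : ℝ := (N * x)⁻¹ with hy
  have hypos : 0 < y := by positivity
  set K : ℂ := (-1) ^ m * ((N : ℂ) ^ m)⁻¹ * ((x : ℂ) ^ (2 * m))⁻¹ with hK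
  have hrefl (t : ℝ) : G (((2 * m - c : ℝ) : ℂ) + t * Complex.I) =
      K * ((y : ℂ) ^ (-((c : ℂ) + (-t : ℝ) * Complex.I)) * Λ (c + (-t : ℝ) * Complex.I)) := by
    set s : ℂ := c + (-t : ℝ) * Complex.I with hs
    have e : (((2 * m - c : ℝ) : ℂ) + t * Complex.I) = 2 * m - s := by
      rw [hs]; push_cast; ring
    rw [e, hG]
    simp only
    rw [hFE (2 * m - s), show (2 * (m : ℂ) - (2 * m - s)) = s by ring,
      show ((m : ℂ) - (2 * m - s)) = s - m by ring, show -(2 * (m : ℂ) - s) = s - (2 * m : ℕ) by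
        push_cast; ring, Complex.cpow_sub _ _ hx0, Complex.cpow_sub _ _ hN0, Complex.cpow_natCast,
      Complex.cpow_natCast, hK]
    have e2 : (y : ℂ) ^ (-s) = (N : ℂ) ^ s * (x : ℂ) ^ s := by
      rw [hy, ofReal_inv, Complex.inv_cpow, Complex.cpow_neg, inv_inv]
      · rw [ofReal_mul, Complex.mul_cpow_ofReal_nonneg (by positivity) hx.le]
        simp
      · rw [Complex.arg_ofReal_of_nonneg (by positivity)]
        exact Real.pi_pos.ne
    rw [e2]
    field_simp
  have hHint : Integrable fun t : ℝ =>
      (y : ℂ) ^ (-((c : ℂ) + t * Complex.I)) * Λ (c + t * Complex.I) := hGint' hypos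
  have hGint2 : Integrable fun t : ℝ => G (((2 * m - c : ℝ) : ℂ) + t * Complex.I) := by
    simp only [hrefl]
    exact (hHint.comp_neg).const_mul K
  obtain ⟨C, hC⟩ := hΛbdd (2 * m - c) c
  have hGb : ∀ s : ℂ, 2 * m - c ≤ s.re → s.re ≤ c →
      ‖G s‖ ≤ (x ^ (-(2 * m - c)) + x ^ (-c)) * C := by
    intro s h1 h2
    have hx' : x ^ (-s.re) ≤ x ^ (-(2 * m - c)) + x ^ (-c) := by
      rcases le_total 1 x with h | h
      · exact (Real.rpow_le_rpow_of_exponent_le h (by linarith)).trans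
          (le_add_of_nonneg_right (by positivity))
      · exact (Real.rpow_le_rpow_of_exponent_ge hx h (by linarith)).trans
          (le_add_of_nonneg_left (by positivity))
    rw [hG]
    simp only [norm_mul]
    rw [Complex.norm_cpow_eq_rpow_re_of_pos hx]
    have := hC s h1 h2
    simp only [neg_re]
    gcongr
  have hshift := integral_vertical_line_eq hGd (by linarith) hGb hGint2 (hGint' hx)
  calc φ x = (1 / (2 * Real.pi)) • ∫ t : ℝ, G (c + t * Complex.I) := hinv hx
    _ = (1 / (2 * Real.pi)) • ∫ t : ℝ, G (((2 * m - c : ℝ) : ℂ) + t * Complex.I) := by rw [hshift]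
    _ = (1 / (2 * Real.pi)) • (K * ∫ t : ℝ,
          (y : ℂ) ^ (-((c : ℂ) + t * Complex.I)) * Λ (c + t * Complex.I)) := by
        simp only [hrefl]
        rw [integral_const_mul, integral_neg_eq_self (fun t : ℝ =>
          (y : ℂ) ^ (-((c : ℂ) + t * Complex.I)) * Λ (c + t * Complex.I)) volume]
    _ = K * φ y := by rw [hinv hypos, mul_smul_comm]

/-- Hecke's converse theorem: the functional equation of the completed `L`-function gives
invariance under the Fricke involution. -/
theorem qSeries_fricke (ha : ∀ n : ℕ, 1 ≤ n → ‖a n‖ ≤ M * (n : ℝ) ^ A) {c₀ : ℝ} {L Λ : ℂ → ℂ}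
    (hL : ∀ s : ℂ, c₀ < s.re →
      HasSum (fun n : ℕ => a (n + 1) * ((n + 1 : ℕ) : ℂ) ^ (-s)) (L s))
    (hΛ : ∀ s : ℂ, c₀ < s.re → Λ s = (2 * (Real.pi : ℂ)) ^ (-s) * Complex.Gamma s * L s)
    (hΛdiff : Differentiable ℂ Λ)
    (hΛbdd : ∀ A B : ℝ, ∃ C : ℝ, ∀ s : ℂ, A ≤ s.re → s.re ≤ B → ‖Λ s‖ ≤ C)
    {m N : ℕ} (hN : 0 < N)
    (hFE : ∀ s : ℂ, Λ s = (-1 : ℂ) ^ m * (N : ℂ) ^ ((m : ℂ) - s) * Λ (2 * m - s)) {z : ℂ}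
    (hz : 0 < z.im) :
    (N : ℂ) ^ m * z ^ (2 * m) * qSeries a z = qSeries a (-1 / (N * z)) := by
  have hopen : IsOpen {z : ℂ | 0 < z.im} := isOpen_lt continuous_const Complex.continuous_im
  have hN0 : (N : ℂ) ≠ 0 := by exact_mod_cast hN.ne'
  have hz0 {z : ℂ} (hz : 0 < z.im) : z ≠ 0 := fun h => by simp [h] at hz
  have hd := differentiableOn_qSeries ha
  have hmap {z : ℂ} (hz : 0 < z.im) : 0 < (-1 / (N * z)).im := by
    have e : -1 / (N * z) = (((N : ℝ)⁻¹ : ℝ) : ℂ) * (-z⁻¹) := by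
      have := hz0 hz
      push_cast
      field_simp
    have := Complex.normSq_pos.2 (hz0 hz)
    rw [e, Complex.im_ofReal_mul, neg_im, Complex.inv_im]
    have : 0 < z.im / Complex.normSq z := by positivity
    rw [neg_div, neg_neg]
    positivity
  have h1 : DifferentiableOn ℂ (fun z => (N : ℂ) ^ m * z ^ (2 * m) * qSeries a z)
      {z : ℂ | 0 < z.im} := by fun_prop
  have h2 : DifferentiableOn ℂ (fun z => qSeries a (-1 / (N * z))) {z : ℂ | 0 < z.im} := by
    refine hd.comp (fun z hz => ?_) fun z hz => hmap hz
    have := hz0 hz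
    exact (DifferentiableAt.div (by fun_prop) (by fun_prop)
      (mul_ne_zero hN0 this)).differentiableWithinAt
  have hconn : IsPreconnected {z : ℂ | 0 < z.im} := (convex_halfSpace_im_gt 0).isPreconnected
  refine (h1.analyticOnNhd hopen).eqOn_of_preconnected_of_frequently_eq
    (h2.analyticOnNhd hopen) hconn (z₀ := Complex.I) (by simp) ?_ hz
  have htend : Tendsto (fun x : ℝ => (x : ℂ) * Complex.I) (𝓝[>] 1) (𝓝[≠] Complex.I) := by
    refine tendsto_nhdsWithin_iff.2 ⟨?_, ?_⟩
    · have : Continuous fun x : ℝ => (x : ℂ) * Complex.I := by fun_prop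
      simpa using (this.tendsto 1).mono_left nhdsWithin_le_nhds
    · filter_upwards [self_mem_nhdsWithin] with x hx h
      have : x = 1 := by simpa using congrArg Complex.im h
      exact absurd this (ne_of_gt hx)
  refine htend.frequently (Eventually.frequently ?_)
  filter_upwards [self_mem_nhdsWithin] with x hx
  have hx : 0 < x := zero_lt_one.trans hx
  have hx0 : (x : ℂ) ≠ 0 := by exact_mod_cast hx.ne'
  rw [qSeries_imaginary_axis ha hL hΛ hΛdiff hΛbdd hN hFE hx,
    show -1 / ((N : ℂ) * (x * Complex.I)) = (((N * x : ℝ)⁻¹ : ℝ) : ℂ) * Complex.I by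
      have := Complex.I_ne_zero
      push_cast
      field_simp
      rw [Complex.I_sq],
    mul_pow, pow_mul Complex.I, Complex.I_sq]
  have : ((-1 : ℂ) ^ m) * (-1) ^ m = 1 := by rw [← mul_pow]; simp
  generalize qSeries a (((N * x : ℝ)⁻¹ : ℝ) * Complex.I) = q
  field_simp
  linear_combination q * this

end

section mobius

lemma im_mobius (a b c d : ℤ) (z : ℂ) :
    ((a * z + b) / (c * z + d)).im = (a * d - b * c : ℤ) * z.im / normSq (c * z + d) := by
  rw [Complex.div_im]
  simp
  ring

lemma mobius_denom_ne_zero {a b c d : ℤ} (h : 0 < a * d - b * c) {z : ℂ} (hz : 0 < z.im) :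
    (c * z + d : ℂ) ≠ 0 := by
  intro h0
  have him : (c : ℝ) * z.im = 0 := by simpa using congrArg Complex.im h0
  have hc : c = 0 := by
    rcases mul_eq_zero.1 him with h | h
    · exact_mod_cast h
    · exact absurd h hz.ne'
  have hd : d = 0 := by simpa [hc] using h0
  simp [hc, hd] at h

lemma im_mobius_pos {a b c d : ℤ} (h : 0 < a * d - b * c) {z : ℂ} (hz : 0 < z.im) :
    0 < ((a * z + b) / (c * z + d)).im := by
  rw [im_mobius]
  have := normSq_pos.2 (mobius_denom_ne_zero h hz)
  have h' : (0 : ℝ) < (a * d - b * c : ℤ) := by exact_mod_cast h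
  positivity

end mobius

section
open Filter Topology Function Function.Periodic
open scoped ModularForm MatrixGroups Manifold

/-- A periodic function of polynomial growth in `im z`, holomorphic on the upper half-plane, is
bounded near `i∞`. -/
lemma Function.Periodic.exists_bound_of_polynomial_growth {F : ℂ → ℂ} {h C : ℝ} {E : ℕ}
    (hh : 0 < h) (hF : Periodic F h) (hdiff : ∀ z : ℂ, 0 < z.im → DifferentiableAt ℂ F z)
    (hC : ∀ z : ℂ, 1 ≤ z.im → |z.re| ≤ h → ‖F z‖ ≤ C * z.im ^ E) :
    ∃ B Y : ℝ, ∀ z : ℂ, Y ≤ z.im → ‖F z‖ ≤ B := by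
  have hC' (z : ℂ) (hz : 1 ≤ z.im) : ‖F z‖ ≤ C * z.im ^ E := by
    set n : ℤ := ⌊z.re / h⌋ with hn
    have h1 : F (z - n * h) = F z := hF.sub_int_mul_eq n
    have h2 := Int.floor_le (z.re / h)
    have h3 := Int.lt_floor_add_one (z.re / h)
    rw [le_div_iff₀ hh] at h2
    rw [div_lt_iff₀ hh] at h3
    have h4 := hC (z - n * h) (by simpa using hz) (by
      rw [abs_le]
      constructor <;> simp <;> nlinarith)
    simpa [h1] using h4
  set G : ℂ → ℂ := cuspFunction h F with hG
  have hev : ∀ᶠ z in comap Complex.im atTop, (0 : ℝ) < z.im :=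
    tendsto_comap.eventually (eventually_gt_atTop 0)
  have hGd : ∀ᶠ q in 𝓝[≠] (0 : ℂ), DifferentiableAt ℂ G q :=
    eventually_differentiableAt_cuspFunction_nhds_ne_zero hh hF (hev.mono fun z hz => hdiff z hz)
  have hlog : (fun q : ℂ => (Real.log ‖q‖⁻¹) ^ E) =o[𝓝[≠] (0 : ℂ)] fun q : ℂ => (q - 0)⁻¹ := by
    have h1 : Tendsto (fun q : ℂ => ‖q‖⁻¹) (𝓝[≠] 0) atTop :=
      tendsto_inv_nhdsGT_zero.comp tendsto_norm_nhdsNE_zero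
    refine Asymptotics.isLittleO_norm_right.1 ?_
    simpa [Function.comp_def] using (Real.isLittleO_pow_log_id_atTop (n := E)).comp_tendsto h1
  have hconst : (fun _ : ℂ => G 0) =o[𝓝[≠] (0 : ℂ)] fun q : ℂ => (q - 0)⁻¹ := by
    refine Asymptotics.isLittleO_const_left.2 (Or.inr ?_)
    have h1 : Tendsto (fun q : ℂ => ‖q‖⁻¹) (𝓝[≠] 0) atTop :=
      tendsto_inv_nhdsGT_zero.comp tendsto_norm_nhdsNE_zero
    simpa [Function.comp_def] using h1
  have hGO : G =O[𝓝[≠] (0 : ℂ)] fun q : ℂ => (Real.log ‖q‖⁻¹) ^ E := by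
    refine Asymptotics.IsBigO.of_bound (C * (h / (2 * Real.pi)) ^ E) ?_
    have h1 : ∀ᶠ q in 𝓝[≠] (0 : ℂ), 1 ≤ (invQParam h q).im :=
      (invQParam_tendsto hh).eventually (tendsto_comap.eventually (eventually_ge_atTop 1))
    filter_upwards [h1, self_mem_nhdsWithin] with q hq hq0
    rw [hG, cuspFunction_eq_of_nonzero _ _ hq0]
    refine (hC' _ hq).trans ?_
    rw [im_invQParam, Real.log_inv, mul_assoc, norm_pow, Real.norm_eq_abs, abs_neg]
    rw [im_invQParam] at hq
    have e : -h / (2 * Real.pi) * Real.log ‖q‖ = h / (2 * Real.pi) * |Real.log ‖q‖| := by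
      rw [abs_of_neg]
      · ring
      · by_contra hcon
        have : 0 < h / (2 * Real.pi) := by positivity
        rw [neg_div] at hq
        nlinarith
    rw [e, mul_pow]
  have ht := tendsto_limUnder_of_differentiable_on_punctured_nhds_of_isLittleO (c := 0) hGd
    ((hGO.trans_isLittleO hlog).sub hconst)
  have ht' : Tendsto F (comap Complex.im atTop) (𝓝 (limUnder (𝓝[≠] 0) G)) := by
    have := ht.comp (qParam_tendsto hh)
    refine this.congr fun z => ?_
    simp only [Function.comp_apply, hG]
    exact eq_cuspFunction hh.ne' hF z
  obtain ⟨B, hB⟩ := ht'.norm.isBoundedUnder_le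
  rw [eventually_map, eventually_comap] at hB
  obtain ⟨Y, hY⟩ := eventually_atTop.1 hB
  exact ⟨B, Y, fun z hz => hY z.im hz z rfl⟩

/-- A holomorphic function of moderate growth that is invariant under `Γ₀(N)` is a modular form. -/
lemma exists_modularForm_of_moderate_growth {N k E : ℕ} (hN : 0 < N) {f : ℂ → ℂ} {C : ℝ}
    (hf : DifferentiableOn ℂ f {z | 0 < z.im})
    (hC : ∀ z : ℂ, 0 < z.im → ‖f z‖ ≤ C * (z.im ^ E)⁻¹)
    (hinv : ∀ a b c d : ℤ, a * d - b * c = 1 → (N : ℤ) ∣ c → ∀ z : ℂ, 0 < z.im →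
      f ((a * z + b) / (c * z + d)) = (c * z + d) ^ k * f z) :
    ∃ F : ModularForm (CongruenceSubgroup.Gamma0 N) k, ∀ z : ℍ, F z = f z := by
  have hC0 : 0 ≤ C := by
    have := (norm_nonneg _).trans (hC Complex.I (by simp))
    simpa using this
  have hslash (γ : Matrix.SpecialLinearGroup (Fin 2) ℤ)
      (hγ : γ ∈ CongruenceSubgroup.Gamma0 N) :
      (fun z : ℍ => f z) ∣[(k : ℤ)] γ = fun z : ℍ => f z := by
    ext z
    have hdet : γ 0 0 * γ 1 1 - γ 0 1 * γ 1 0 = 1 := by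
      rw [← Matrix.det_fin_two]; exact γ.det_coe
    have h := hinv (γ 0 0) (γ 0 1) (γ 1 0) (γ 1 1) hdet (by
      have := CongruenceSubgroup.Gamma0_mem.1 hγ
      rwa [ZMod.intCast_zmod_eq_zero_iff_dvd, ] at this) z z.im_pos
    have hd := UpperHalfPlane.denom_ne_zero γ z
    rw [ModularForm.SL_slash_apply, UpperHalfPlane.coe_specialLinearGroup_apply]
    simp only [algebraMap_int_eq, Int.coe_castRingHom, ofReal_intCast]
    rw [h, ModularGroup.denom_apply]
    rw [ModularGroup.denom_apply] at hd
    rw [zpow_neg, zpow_natCast]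
    field_simp
  have hbdd (γ : Matrix.SpecialLinearGroup (Fin 2) ℤ) :
      IsBoundedAtImInfty ((fun z : ℍ => f z) ∣[(k : ℤ)] γ) := by
    obtain ⟨p, q, r, s, hγ⟩ : ∃ p q r s : ℤ, γ 0 0 = p ∧ γ 0 1 = q ∧ γ 1 0 = r ∧ γ 1 1 = s :=
      ⟨_, _, _, _, rfl, rfl, rfl, rfl⟩
    obtain ⟨h00, h01, h10, h11⟩ := hγ
    have hdet : p * s - q * r = 1 := by
      rw [← h00, ← h01, ← h10, ← h11, ← Matrix.det_fin_two]; exact γ.det_coe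
    have hdet0 : 0 < p * s - q * r := by omega
    set H : ℂ → ℂ := fun z => if 0 < z.im then
      f ((p * z + q) / (r * z + s)) * ((r * z + s) ^ k)⁻¹ else 0 with hH
    have hper : Function.Periodic H (N : ℝ) := by
      intro z
      simp only [hH, add_im, ofReal_im, add_zero]
      split_ifs with hz
      · have hz' : 0 < (z + (N : ℝ)).im := by simpa using hz
        have hw := mobius_denom_ne_zero hdet0 hz
        have hw' := mobius_denom_ne_zero hdet0 hz'
        have h := hinv (1 - N * p * r) (N * p ^ 2) (-(N * r ^ 2)) (1 + N * p * r) (by ring)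
          (Dvd.intro (-r ^ 2) (by ring)) _ (im_mobius_pos hdet0 hz)
        have hdetC : (p : ℂ) * s - q * r = 1 := by exact_mod_cast hdet
        push_cast at h hw' ⊢
        have e1 : (-(N * r ^ 2) * ((p * z + q) / (r * z + s)) + (1 + N * p * r) : ℂ) =
            (r * (z + N) + s) / (r * z + s) := by
          field_simp
          linear_combination (N : ℂ) * r * hdetC
        have e2 : ((1 - N * p * r) * ((p * z + q) / (r * z + s)) + N * p ^ 2 : ℂ) =
            (p * (z + N) + q) / (r * z + s) := by
          field_simp
          linear_combination (N : ℂ) * p * hdetC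
        rw [e1, e2, div_div_div_cancel_right₀ hw] at h
        rw [h, div_pow]
        field_simp
      · rfl
    have hdiff (z : ℂ) (hz : 0 < z.im) : DifferentiableAt ℂ H z := by
      have hopen : IsOpen {z : ℂ | 0 < z.im} := isOpen_lt continuous_const Complex.continuous_im
      have hw := mobius_denom_ne_zero hdet0 hz
      have h1 : DifferentiableAt ℂ f ((p * z + q) / (r * z + s)) :=
        hf.differentiableAt (hopen.mem_nhds (im_mobius_pos hdet0 hz))
      have h2 : DifferentiableAt ℂ (fun z : ℂ => ((p : ℂ) * z + q) / (r * z + s)) z :=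
        DifferentiableAt.div (by fun_prop) (by fun_prop) hw
      have h3 : DifferentiableAt ℂ (fun z : ℂ => (((r : ℂ) * z + s) ^ k)⁻¹) z :=
        DifferentiableAt.inv (by fun_prop) (pow_ne_zero _ hw)
      refine ((h1.comp z h2).mul h3).congr_of_eventuallyEq ?_
      filter_upwards [hopen.mem_nhds hz] with w hw
      simp only [hH, if_pos (show 0 < w.im from hw)]
      rfl
    have hrs : 1 ≤ |r| ∨ (r = 0 ∧ |s| = 1) := by
      rcases eq_or_ne r 0 with h | h
      · right
        refine ⟨h, ?_⟩
        rw [h] at hdet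
        exact Int.isUnit_iff_abs_eq.1 (IsUnit.of_mul_eq_one p (by linarith))
      · left; exact Int.one_le_abs h
    have hgrowth (z : ℂ) (hz : 1 ≤ z.im) (hre : |z.re| ≤ N) :
        ‖H z‖ ≤ C * (|(r : ℝ)| * (N + 1) + |(s : ℝ)|) ^ (2 * E) * z.im ^ (2 * E) := by
      have hz0 : 0 < z.im := by linarith
      have hw := mobius_denom_ne_zero hdet0 hz0
      simp only [hH, if_pos hz0]
      have h1 := hC _ (im_mobius_pos hdet0 hz0)
      rw [im_mobius, hdet, Int.cast_one, one_mul, normSq_eq_norm_sq] at h1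
      set w : ℂ := r * z + s with hwdef
      have hw1 : 1 ≤ ‖w‖ := by
        rcases hrs with h | ⟨h, h'⟩
        · have h2 := Complex.abs_im_le_norm w
          have h3 : w.im = r * z.im := by simp [hwdef]
          rw [h3, abs_mul, abs_of_pos hz0] at h2
          have h4 : (1 : ℝ) ≤ |(r : ℝ)| := by exact_mod_cast h
          nlinarith
        · have : ‖w‖ = 1 := by
            rw [hwdef, h]
            simp only [Int.cast_zero, zero_mul, zero_add, Complex.norm_intCast]
            exact_mod_cast h'
          exact this.ge
      have hw2 : ‖w‖ ≤ (|(r : ℝ)| * (N + 1) + |(s : ℝ)|) * z.im := by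
        calc ‖w‖ ≤ |(r : ℝ)| * ‖z‖ + |(s : ℝ)| := by
              rw [hwdef]
              refine (norm_add_le _ _).trans ?_
              rw [norm_mul, Complex.norm_intCast, Complex.norm_intCast]
          _ ≤ |(r : ℝ)| * (N + z.im) + |(s : ℝ)| := by
              gcongr
              have := Complex.norm_le_abs_re_add_abs_im z
              rw [abs_of_pos hz0] at this
              linarith
          _ ≤ _ := by
              have h2 : (0 : ℝ) ≤ N * (z.im - 1) := by
                have : (0 : ℝ) ≤ z.im - 1 := by linarith
                positivity
              nlinarith [abs_nonneg (r : ℝ), abs_nonneg (s : ℝ),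
                mul_nonneg (abs_nonneg (r : ℝ)) h2]
      rw [norm_mul, norm_inv, norm_pow]
      calc ‖f ((p * z + q) / w)‖ * (‖w‖ ^ k)⁻¹ ≤ C * ((z.im / ‖w‖ ^ 2) ^ E)⁻¹ * 1 := by
            gcongr
            exact inv_le_one_of_one_le₀ (one_le_pow₀ hw1)
        _ = C * ‖w‖ ^ (2 * E) * (z.im ^ E)⁻¹ := by
            rw [div_pow, inv_div, pow_mul]; ring
        _ ≤ C * ((|(r : ℝ)| * (N + 1) + |(s : ℝ)|) * z.im) ^ (2 * E) * 1 := by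
            gcongr
            exact inv_le_one_of_one_le₀ (one_le_pow₀ hz)
        _ = _ := by rw [mul_pow]; ring
    obtain ⟨B, Y, hB⟩ := Function.Periodic.exists_bound_of_polynomial_growth
      (by exact_mod_cast hN) hper hdiff hgrowth
    rw [isBoundedAtImInfty_iff]
    refine ⟨B, Y, fun z hz => ?_⟩
    have h := hB z hz
    simp only [hH, if_pos (show 0 < (z : ℂ).im from z.im_pos)] at h
    rw [ModularForm.SL_slash_apply, UpperHalfPlane.coe_specialLinearGroup_apply,
      ModularGroup.denom_apply]
    simp only [algebraMap_int_eq, Int.coe_castRingHom, ofReal_intCast, h00, h01, h10, h11]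
    rwa [zpow_neg, zpow_natCast]
  refine ⟨{ toFun := fun z => f z, slash_action_eq' := ?_, holo' := ?_, bdd_at_cusps' := ?_ },
    fun z => rfl⟩
  · rintro _ ⟨γ, hγ, rfl⟩
    exact hslash γ hγ
  · rw [UpperHalfPlane.mdifferentiable_iff]
    refine hf.congr fun z hz => ?_
    simp [UpperHalfPlane.ofComplex_apply_of_im_pos hz]
  · intro c hc
    have hc' : IsCusp c (Matrix.SpecialLinearGroup.mapGL ℝ : SL(2, ℤ) →* GL (Fin 2) ℝ).range :=
      hc.mono (by rintro _ ⟨γ, -, rfl⟩; exact ⟨γ, rfl⟩)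
    exact (OnePoint.isBoundedAt_iff_forall_SL2Z hc').2 fun γ _ => hbdd γ
end

section
open Filter Topology

/-- The local exponents of a nonzero holomorphic function at an elliptic fixed point force the
multiplier to be a root of unity. -/
lemma exists_pow_eq_one_of_elliptic {m : ℕ} (hm : 0 < m) {a b c d : ℤ} {z₀ : ℂ}
    (hdet : 0 < a * d - b * c) (hz₀ : 0 < z₀.im)
    (hfix : (c : ℂ) * z₀ ^ 2 + (d - a) * z₀ - b = 0) {f : ℂ → ℂ}
    (hf : DifferentiableOn ℂ f {z | 0 < z.im})
    (hinv : ∀ z : ℂ, 0 < z.im →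
      ((a * d - b * c : ℤ) : ℂ) ^ m * f ((a * z + b) / (c * z + d)) = (c * z + d) ^ (2 * m) * f z)
    (hne : ∃ z : ℂ, 0 < z.im ∧ f z ≠ 0) :
    ∃ r : ℕ, 0 < r ∧ (((c : ℂ) * z₀ + d) ^ 2 / ((a * d - b * c : ℤ) : ℂ)) ^ r = 1 := by
  have hopen : IsOpen {z : ℂ | 0 < z.im} := isOpen_lt continuous_const Complex.continuous_im
  have han := hf.analyticOnNhd hopen
  have hnz : ¬∀ᶠ z in 𝓝 z₀, f z = 0 := by
    intro h
    obtain ⟨w, hw, hw0⟩ := hne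
    exact hw0 (han.eqOn_zero_of_preconnected_of_eventuallyEq_zero
      (convex_halfSpace_im_gt 0).isPreconnected hz₀ h hw)
  obtain ⟨n, u, hu, hu0, hfu⟩ := (han z₀ hz₀).exists_eventuallyEq_pow_smul_nonzero_iff.2 hnz
  set D : ℂ := ((a * d - b * c : ℤ) : ℂ) with hD
  have hD0 : D ≠ 0 := by rw [hD]; exact_mod_cast hdet.ne'
  set w₀ : ℂ := c * z₀ + d with hw₀
  have hw₀0 : w₀ ≠ 0 := mobius_denom_ne_zero hdet hz₀
  have hDe : D = a * d - b * c := by rw [hD]; push_cast; rfl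
  have hfix' : (a * z₀ + b) / (c * z₀ + d) = z₀ := by
    rw [div_eq_iff hw₀0]; linear_combination -hfix
  have hcont : ContinuousAt (fun z : ℂ => (a * z + b) / (c * z + d)) z₀ :=
    ContinuousAt.div (by fun_prop) (by fun_prop) hw₀0
  have htend : Tendsto (fun z : ℂ => (a * z + b) / (c * z + d)) (𝓝 z₀) (𝓝 z₀) := by
    have := hcont.tendsto
    simp only [hfix'] at this
    exact this
  have hkey : ∀ᶠ z in 𝓝[≠] z₀, D ^ m * (D / ((c * z + d) * w₀)) ^ n *
      u ((a * z + b) / (c * z + d)) = (c * z + d) ^ (2 * m) * u z := by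
    filter_upwards [nhdsWithin_le_nhds hfu, nhdsWithin_le_nhds (htend.eventually hfu),
      nhdsWithin_le_nhds (hopen.mem_nhds hz₀), self_mem_nhdsWithin] with z h1 h2 hz hzz
    have hzz' : (z - z₀) ^ n ≠ 0 := pow_ne_zero _ (sub_ne_zero.2 hzz)
    have hw := mobius_denom_ne_zero hdet hz
    have h3 := hinv z hz
    have e : (a * z + b) / (c * z + d) - z₀ = (D / ((c * z + d) * w₀)) * (z - z₀) := by
      nth_rw 1 [← hfix']
      rw [div_sub_div _ _ hw hw₀0, hDe]
      field_simp
      ring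
    rw [h1, h2, e, smul_eq_mul, smul_eq_mul, mul_pow] at h3
    apply mul_left_cancel₀ hzz'
    linear_combination h3
  have hl : Tendsto (fun z : ℂ => D ^ m * (D / ((c * z + d) * w₀)) ^ n *
      u ((a * z + b) / (c * z + d))) (𝓝[≠] z₀) (𝓝 (D ^ m * (D / (w₀ * w₀)) ^ n * u z₀)) := by
    have h1 : Tendsto (fun z : ℂ => (c : ℂ) * z + d) (𝓝 z₀) (𝓝 w₀) := by
      have : ContinuousAt (fun z : ℂ => (c : ℂ) * z + d) z₀ := by fun_prop
      exact this.tendsto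
    have h2 : Tendsto (fun z : ℂ => u ((a * z + b) / (c * z + d))) (𝓝 z₀) (𝓝 (u z₀)) :=
      Tendsto.comp hu.continuousAt htend
    have h3 : Tendsto (fun z : ℂ => D / ((c * z + d) * w₀)) (𝓝 z₀) (𝓝 (D / (w₀ * w₀))) :=
      tendsto_const_nhds.div (h1.mul_const w₀) (mul_ne_zero hw₀0 hw₀0)
    exact (((h3.pow n).const_mul (D ^ m)).mul h2).mono_left nhdsWithin_le_nhds
  have hr : Tendsto (fun z : ℂ => ((c : ℂ) * z + d) ^ (2 * m) * u z) (𝓝[≠] z₀)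
      (𝓝 (w₀ ^ (2 * m) * u z₀)) := by
    refine Tendsto.mono_left (Tendsto.mul ?_ hu.continuousAt.tendsto) nhdsWithin_le_nhds
    exact ContinuousAt.tendsto (x := z₀) (f := fun z : ℂ => ((c : ℂ) * z + d) ^ (2 * m))
      (by fun_prop)
  have heq := tendsto_nhds_unique (hl.congr' hkey) hr
  have heq' := mul_right_cancel₀ hu0 heq
  refine ⟨n + m, by omega, ?_⟩
  rw [pow_add, div_pow, div_pow, ← pow_mul, ← pow_mul, ← heq', div_pow, ← pow_two, ← pow_mul]
  field_simp

/-- A holomorphic function on the upper half-plane of positive weight that is invariant under an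
elliptic matrix of infinite order vanishes. -/
lemma eq_zero_of_elliptic_invariant {m : ℕ} (hm : 0 < m) {a b c d : ℤ}
    (hell : (a + d) ^ 2 < 4 * (a * d - b * c)) (hdvd : ¬ (a * d - b * c) ∣ (a + d) ^ 2)
    {f : ℂ → ℂ} (hf : DifferentiableOn ℂ f {z | 0 < z.im})
    (hinv : ∀ z : ℂ, 0 < z.im →
      ((a * d - b * c : ℤ) : ℂ) ^ m * f ((a * z + b) / (c * z + d)) = (c * z + d) ^ (2 * m) * f z)
    {z : ℂ} (hz : 0 < z.im) : f z = 0 := by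
  by_contra hfz
  have hdet : 0 < a * d - b * c := by nlinarith [sq_nonneg (a + d)]
  have hc : c ≠ 0 := by
    rintro rfl
    nlinarith [sq_nonneg (a - d)]
  have hcR : (c : ℝ) ≠ 0 := by exact_mod_cast hc
  have hcC : (c : ℂ) ≠ 0 := by exact_mod_cast hc
  have hDR : (0 : ℝ) < 4 * ((a : ℝ) * d - b * c) - (a + d) ^ 2 := by
    have : ((a : ℝ) + d) ^ 2 < 4 * (a * d - b * c) := by exact_mod_cast hell
    linarith
  obtain ⟨s, hs, hsc⟩ : ∃ s : ℝ, s ^ 2 = 4 * ((a : ℝ) * d - b * c) - (a + d) ^ 2 ∧ 0 < s / c := by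
    have h0 := Real.sqrt_pos.2 hDR
    have h1 := Real.sq_sqrt hDR.le
    rcases lt_or_gt_of_ne hcR with h | h
    · exact ⟨-Real.sqrt _, by rw [neg_sq, h1], div_pos_of_neg_of_neg (by linarith) h⟩
    · exact ⟨Real.sqrt _, h1, div_pos h0 h⟩
  have hsC : (s : ℂ) ^ 2 = 4 * ((a : ℂ) * d - b * c) - (a + d) ^ 2 := by exact_mod_cast hs
  set z₀ : ℂ := (a - d + s * Complex.I) / (2 * c) with hz₀
  have hz₀im : 0 < z₀.im := by
    have e : z₀ = ((((a : ℝ) - d) / (2 * c) : ℝ) : ℂ) + ((s / c / 2 : ℝ) : ℂ) * Complex.I := by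
      rw [hz₀]; push_cast; field_simp
    rw [e, Complex.add_im, Complex.ofReal_im, Complex.im_ofReal_mul, Complex.I_im]
    linarith
  have hw₀ : (c : ℂ) * z₀ + d = (a + d + s * Complex.I) / 2 := by
    rw [hz₀]; field_simp; ring
  have hfix : (c : ℂ) * z₀ ^ 2 + (d - a) * z₀ - b = 0 := by
    rw [hz₀]
    field_simp
    linear_combination hsC * Complex.I ^ 2 + (4 * ((a : ℂ) * d - b * c) - (a + d) ^ 2) * Complex.I_sq
  obtain ⟨r, hr, hroot⟩ := exists_pow_eq_one_of_elliptic hm hdet hz₀im hfix hf hinv ⟨z, hz, hfz⟩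
  rw [hw₀] at hroot
  set μ : ℂ := ((a + d + s * Complex.I) / 2) ^ 2 / ((a * d - b * c : ℤ) : ℂ) with hμ
  have hDC : ((a : ℂ) * d - b * c) ≠ 0 := by exact_mod_cast hdet.ne'
  have hμint : IsIntegral ℤ μ := .of_pow hr (by rw [hroot]; exact isIntegral_one)
  have hμint' : IsIntegral ℤ μ⁻¹ := .of_pow hr (by rw [inv_pow, hroot, inv_one]; exact isIntegral_one)
  have hμinv : μ⁻¹ = ((a + d - s * Complex.I) / 2) ^ 2 / ((a * d - b * c : ℤ) : ℂ) := by
    apply inv_eq_of_mul_eq_one_right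
    rw [hμ]
    have e : ((a : ℂ) + d + s * Complex.I) / 2 * ((a + d - s * Complex.I) / 2) = a * d - b * c := by
      linear_combination (1 / 4) * hsC - (s : ℂ) ^ 2 / 4 * Complex.I_sq
    rw [div_mul_div_comm, ← mul_pow, e]
    push_cast
    field_simp
  have hsum : μ + μ⁻¹ = algebraMap ℚ ℂ (((a + d) ^ 2 : ℤ) / ((a * d - b * c : ℤ) : ℚ) - 2) := by
    rw [hμinv, hμ]
    push_cast [eq_ratCast]
    field_simp
    linear_combination 2 * (s : ℂ) ^ 2 * Complex.I_sq - 2 * hsC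
  have hint := hμint.add hμint'
  rw [hsum, isIntegral_algebraMap_iff (algebraMap ℚ ℂ).injective,
    IsIntegrallyClosed.isIntegral_iff] at hint
  obtain ⟨y, hy⟩ := hint
  apply hdvd
  refine ⟨y + 2, ?_⟩
  have hDQ : ((a * d - b * c : ℤ) : ℚ) ≠ 0 := by exact_mod_cast hdet.ne'
  rw [eq_intCast, eq_sub_iff_add_eq, eq_div_iff hDQ] at hy
  have : (y + 2) * (a * d - b * c) = (a + d) ^ 2 := by exact_mod_cast hy
  linarith

end

section intSlash

/-- The weight `2 * m` slash operator of an integral matrix of positive determinant, normalized so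
that scalar matrices act trivially. -/
noncomputable def intSlash (m : ℕ) (a b c d : ℤ) : (ℍ → ℂ) →ₗ[ℂ] (ℍ → ℂ) where
  toFun h z := ((a * d - b * c : ℤ) : ℂ) ^ m * ((c * z + d : ℂ) ^ (2 * m))⁻¹ *
    h (ofComplex ((a * z + b) / (c * z + d)))
  map_add' h₁ h₂ := by ext z; simp only [Pi.add_apply]; ring
  map_smul' r h := by ext z; simp only [Pi.smul_apply, smul_eq_mul, RingHom.id_apply]; ring

variable {m : ℕ} {h : ℍ → ℂ}

lemma intSlash_apply (a b c d : ℤ) (z : ℍ) :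
    intSlash m a b c d h z = ((a * d - b * c : ℤ) : ℂ) ^ m * ((c * z + d : ℂ) ^ (2 * m))⁻¹ *
      h (ofComplex ((a * z + b) / (c * z + d))) := rfl

lemma intSlash_scalar_mul {r : ℤ} (hr : r ≠ 0) (a b c d : ℤ) :
    intSlash m (r * a) (r * b) (r * c) (r * d) h = intSlash m a b c d h := by
  ext z
  have hr' : (r : ℂ) ≠ 0 := by exact_mod_cast hr
  have e1 : (((r * a : ℤ) : ℂ) * z + (r * b : ℤ)) / ((r * c : ℤ) * z + (r * d : ℤ)) =
      (a * z + b) / (c * z + d) := by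
    rw [← mul_div_mul_left (a * z + b : ℂ) _ hr']
    push_cast
    congr 1 <;> ring
  have e2 : (((r * c : ℤ) : ℂ) * z + (r * d : ℤ)) = r * (c * z + d) := by push_cast; ring
  have e3 : ((r * a * (r * d) - r * b * (r * c) : ℤ) : ℂ) = r ^ 2 * (a * d - b * c : ℤ) := by
    push_cast; ring
  rw [intSlash_apply, intSlash_apply, e1, e2, e3, mul_pow, mul_pow, ← pow_mul, mul_inv]
  field_simp

lemma intSlash_self {r : ℤ} (hr : r ≠ 0) : intSlash m r 0 0 r h = h := by
  have := intSlash_scalar_mul (m := m) (h := h) hr 1 0 0 1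
  simp only [mul_one, mul_zero] at this
  rw [this]
  ext z
  simp [intSlash_apply]

lemma intSlash_comp {a b c d a' b' c' d' : ℤ} (h₁ : 0 < a * d - b * c)
    (h₂ : 0 < a' * d' - b' * c') :
    intSlash m a' b' c' d' (intSlash m a b c d h) =
      intSlash m (a * a' + b * c') (a * b' + b * d') (c * a' + d * c') (c * b' + d * d') h := by
  ext z
  have hw' := mobius_denom_ne_zero h₂ z.im_pos
  have hp := im_mobius_pos h₂ z.im_pos
  have hw := mobius_denom_ne_zero h₁ hp
  have e0 : (c * ((a' * z + b') / (c' * z + d')) + d : ℂ) =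
      (((c * a' + d * c' : ℤ) : ℂ) * z + (c * b' + d * d' : ℤ)) / (c' * z + d') := by
    rw [eq_div_iff hw', add_mul, mul_assoc, div_mul_cancel₀ _ hw']
    push_cast
    ring
  have hw'' : (((c * a' + d * c' : ℤ) : ℂ) * z + (c * b' + d * d' : ℤ)) ≠ 0 := by
    intro h0
    rw [e0, h0, zero_div] at hw
    exact hw rfl
  simp only [intSlash_apply]
  rw [ofComplex_apply_of_im_pos hp]
  have e1 : (a * ((a' * z + b') / (c' * z + d')) + b : ℂ) / (c * ((a' * z + b') / (c' * z + d')) + d)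
      = (((a * a' + b * c' : ℤ) : ℂ) * z + (a * b' + b * d' : ℤ)) /
        (((c * a' + d * c' : ℤ) : ℂ) * z + (c * b' + d * d' : ℤ)) := by
    rw [e0, div_div_eq_mul_div]
    congr 1
    rw [add_mul, mul_assoc, div_mul_cancel₀ _ hw']
    push_cast
    ring
  have e2 : (((a * a' + b * c') * (c * b' + d * d') - (a * b' + b * d') * (c * a' + d * c') : ℤ) : ℂ)
      = (a * d - b * c : ℤ) * (a' * d' - b' * c' : ℤ) := by push_cast; ring
  rw [e1, e0, e2, div_pow, mul_pow, inv_div]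
  field_simp

lemma intSlash_comp_eq {a b c d a' b' c' d' : ℤ} (A B C D : ℤ) (r : ℤ)
    (hr : r ≠ 0 := by norm_num)
    (h₁ : 0 < a * d - b * c := by norm_num) (h₂ : 0 < a' * d' - b' * c' := by norm_num)
    (eA : a * a' + b * c' = r * A := by norm_num) (eB : a * b' + b * d' = r * B := by norm_num)
    (eC : c * a' + d * c' = r * C := by norm_num) (eD : c * b' + d * d' = r * D := by norm_num) :
    intSlash m a' b' c' d' (intSlash m a b c d h) = intSlash m A B C D h := by
  rw [intSlash_comp h₁ h₂, eA, eB, eC, eD, intSlash_scalar_mul hr]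

lemma intSlash_factor {A B C D : ℤ} (a b c d a' b' c' d' : ℤ) (r : ℤ)
    (hr : r ≠ 0 := by norm_num)
    (h₁ : 0 < a * d - b * c := by norm_num) (h₂ : 0 < a' * d' - b' * c' := by norm_num)
    (eA : a * a' + b * c' = r * A := by norm_num) (eB : a * b' + b * d' = r * B := by norm_num)
    (eC : c * a' + d * c' = r * C := by norm_num) (eD : c * b' + d * d' = r * D := by norm_num) :
    intSlash m A B C D h = intSlash m a' b' c' d' (intSlash m a b c d h) :=
  (intSlash_comp_eq A B C D r hr h₁ h₂ eA eB eC eD).symm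

lemma intSlash_eq_neg_of_inverse {a b c d : ℤ} (hdet : a * d - b * c = 1)
    (hneg : intSlash m a b c d h = -h) : intSlash m d (-b) (-c) a h = -h := by
  have e : intSlash m d (-b) (-c) a (intSlash m a b c d h) = h := by
    rw [intSlash_comp_eq 1 0 0 1 1 one_ne_zero (by linarith) (by linarith) (by linarith) (by ring)
      (by ring) (by linarith), intSlash_self one_ne_zero]
  rw [hneg, map_neg] at e
  exact (neg_eq_iff_eq_neg.1 e)

lemma intSlash_eq_smul_of_mul (p q r s : ℤ) {δ : ℂ} (hδ : intSlash m p q r s h = δ • h)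
    {A B C D : ℤ} {ε : ℂ} (hε : intSlash m A B C D h = ε • h) {a b c d : ℤ}
    (h₁ : A * D - B * C = 1) (h₂ : p * s - q * r = 1 := by norm_num)
    (ea : A * p + B * r = a := by ring) (eb : A * q + B * s = b := by ring)
    (ec : C * p + D * r = c := by ring) (ed : C * q + D * s = d := by ring) :
    intSlash m a b c d h = (ε * δ) • h := by
  rw [← ea, ← eb, ← ec, ← ed, ← intSlash_comp (by linarith) (by linarith), hε, map_smul, hδ,
    smul_smul]

lemma intSlash_fricke_comp {M p : ℤ} (hM : 0 < M) (hp : 0 < p) (x : ℤ)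
    (hW : intSlash m 0 (-1) M 0 h = h) :
    intSlash m 0 (-1) M 0 (intSlash m 1 x 0 p h) = intSlash m p 0 (-(M * x)) 1 h := by
  conv_rhs => rw [← hW]
  rw [intSlash_comp (by linarith) (by linarith), intSlash_comp (by linarith) (by linarith)]
  congr 2 <;> ring

lemma intSlash_fricke_comp' {M p : ℤ} (hM : 0 < M) (hp : 0 < p)
    (hW : intSlash m 0 (-1) M 0 h = h) :
    intSlash m 0 (-1) M 0 (intSlash m p 0 0 1 h) = intSlash m 1 0 0 p h := by
  conv_rhs => rw [← hW]
  rw [intSlash_comp (by linarith) (by linarith), intSlash_comp (by linarith) (by linarith)]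
  congr 2 <;> ring

lemma intSlash_eq_of_inverse {a b c d : ℤ} (hdet : a * d - b * c = 1)
    (hinv : intSlash m a b c d h = h) : intSlash m d (-b) (-c) a h = h := by
  conv_lhs => rw [← hinv]
  rw [intSlash_comp_eq 1 0 0 1 1 one_ne_zero (by linarith) (by linarith) (by linarith) (by ring)
    (by ring) (by linarith), intSlash_self one_ne_zero]

/-- Functions that are holomorphic on the upper half-plane. -/
def IsHol (h : ℍ → ℂ) : Prop :=
  DifferentiableOn ℂ (fun z => h (ofComplex z)) {z | 0 < z.im}

lemma IsHol.add {h₁ h₂ : ℍ → ℂ} (h : IsHol h₁) (h' : IsHol h₂) : IsHol (h₁ + h₂) :=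
  DifferentiableOn.add h h'

lemma IsHol.sub {h₁ h₂ : ℍ → ℂ} (h : IsHol h₁) (h' : IsHol h₂) : IsHol (h₁ - h₂) :=
  DifferentiableOn.sub h h'

lemma IsHol.intSlash (hh : IsHol h) {a b c d : ℤ} (hdet : 0 < a * d - b * c) :
    IsHol (intSlash m a b c d h) := by
  have h1 : DifferentiableOn ℂ (fun z : ℂ => ((a * d - b * c : ℤ) : ℂ) ^ m *
      ((c * z + d : ℂ) ^ (2 * m))⁻¹ * h (ofComplex ((a * z + b) / (c * z + d))))
      {z | 0 < z.im} := by
    refine DifferentiableOn.mul (DifferentiableOn.const_mul (DifferentiableOn.inv (by fun_prop) ?_) _) ?_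
    · exact fun z hz => pow_ne_zero _ (mobius_denom_ne_zero hdet hz)
    · refine DifferentiableOn.comp (g := fun z => h (ofComplex z)) hh
        (DifferentiableOn.div (by fun_prop) (by fun_prop)
          fun z hz => mobius_denom_ne_zero hdet hz) fun z hz => im_mobius_pos hdet hz
  refine h1.congr fun z hz => ?_
  simp only [intSlash_apply]
  rw [ofComplex_apply_of_im_pos hz]

lemma IsHol.eq_zero_of_elliptic (hh : IsHol h) (hm : 0 < m) {a b c d : ℤ}
    (hell : (a + d) ^ 2 < 4 * (a * d - b * c)) (hdvd : ¬ (a * d - b * c) ∣ (a + d) ^ 2)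
    (hinv : _root_.intSlash m a b c d h = h) : h = 0 := by
  have hdet : 0 < a * d - b * c := by nlinarith [sq_nonneg (a + d)]
  ext z
  have key := eq_zero_of_elliptic_invariant hm hell hdvd hh (fun w hw => ?_) z.im_pos
  · simpa using key
  · have hw0 := pow_ne_zero (2 * m) (mobius_denom_ne_zero hdet hw)
    rw [ofComplex_apply_of_im_pos hw, ← inv_mul_eq_iff_eq_mul₀ hw0]
    refine Eq.trans ?_ (congrFun hinv ⟨w, hw⟩)
    rw [intSlash_apply]
    ring

end intSlash

section hecke

lemma sum_exp_div (p n : ℕ) (hp : 0 < p) :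
    ∑ j ∈ Finset.range p, cexp (2 * (Real.pi : ℂ) * Complex.I * n * j / p) =
      if p ∣ n then (p : ℂ) else 0 := by
  have hp0 : (p : ℂ) ≠ 0 := by exact_mod_cast hp.ne'
  set ζ := cexp (2 * (Real.pi : ℂ) * Complex.I * n / p) with hζ
  have e : ∀ j : ℕ, cexp (2 * (Real.pi : ℂ) * Complex.I * n * j / p) = ζ ^ j := by
    intro j
    rw [hζ, ← Complex.exp_nat_mul]
    congr 1
    ring
  have hζ1 : ζ = 1 ↔ p ∣ n := by
    rw [hζ, Complex.exp_eq_one_iff]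
    constructor
    · rintro ⟨k, hk⟩
      have : (n : ℂ) = k * p := by
        have h2 := Complex.two_pi_I_ne_zero
        rw [div_eq_iff hp0] at hk
        apply mul_left_cancel₀ h2
        linear_combination hk
      have : (n : ℤ) = k * p := by exact_mod_cast this
      exact Int.natCast_dvd_natCast.1 ⟨k, by rw [this, mul_comm]⟩
    · rintro ⟨k, rfl⟩
      refine ⟨k, ?_⟩
      push_cast
      field_simp
  have hζp : ζ ^ p = 1 := by
    rw [hζ, ← Complex.exp_nat_mul, Complex.exp_eq_one_iff]
    exact ⟨n, by push_cast; field_simp⟩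
  simp only [e]
  split_ifs with h
  · simp [hζ1.2 h]
  · have h1 := mul_neg_geom_sum ζ p
    rw [hζp, sub_self] at h1
    exact (mul_eq_zero.1 h1).resolve_left (sub_ne_zero.2 fun h' => h (hζ1.1 h'.symm))

lemma tsum_ite_dvd_succ {p : ℕ} (hp : 0 < p) (u : ℕ → ℂ) :
    ∑' n : ℕ, (if p ∣ n + 1 then u (n + 1) else 0) = ∑' n : ℕ, u (p * (n + 1)) := by
  have hs : ∀ n, p * (n + 1) - 1 + 1 = p * (n + 1) := fun n =>
    Nat.sub_add_cancel (Nat.mul_pos hp n.succ_pos)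
  have hinj : Function.Injective fun n : ℕ => p * (n + 1) - 1 := by
    intro x y hxy
    have : p * (x + 1) = p * (y + 1) := by
      rw [← hs x, ← hs y]
      exact congrArg (· + 1) hxy
    have := Nat.eq_of_mul_eq_mul_left hp this
    omega
  rw [← hinj.tsum_eq]
  · refine tsum_congr fun n => ?_
    simp [hs]
  · intro n hn
    by_cases hd : p ∣ n + 1
    · obtain ⟨k, hk⟩ := hd
      have hk0 : k ≠ 0 := by rintro rfl; simp at hk
      refine ⟨k - 1, ?_⟩
      show p * (k - 1 + 1) - 1 = n
      rw [Nat.sub_add_cancel (Nat.one_le_iff_ne_zero.2 hk0), ← hk]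
      simp
    · simp [hd] at hn

variable {a : ℕ → ℂ} {M : ℝ} {A : ℕ}

lemma sum_qSeries_add_div (ha : ∀ n, 1 ≤ n → ‖a n‖ ≤ M * (n : ℝ) ^ A) {p : ℕ} (hp : 0 < p) {z : ℂ}
    (hz : 0 < z.im) :
    ∑ j ∈ Finset.range p, qSeries a ((z + j) / p) =
      p * ∑' n : ℕ, a (p * (n + 1)) *
        cexp (2 * (Real.pi : ℂ) * Complex.I * ((n + 1 : ℕ) : ℂ) * z) := by
  have hp0 : (p : ℂ) ≠ 0 := by exact_mod_cast hp.ne'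
  have him : ∀ j : ℕ, 0 < ((z + j) / p).im := by
    intro j
    have : ((z + j) / p).im = z.im / p := by
      rw [show (p : ℂ) = ((p : ℝ) : ℂ) by push_cast; rfl, Complex.div_ofReal_im]
      simp
    rw [this]
    positivity
  simp only [qSeries]
  rw [← Summable.tsum_finsetSum fun j _ => summable_qSeries ha (him j), ← tsum_mul_left]
  have hterm : ∀ n : ℕ, ∑ j ∈ Finset.range p,
      a (n + 1) * cexp (2 * (Real.pi : ℂ) * Complex.I * ((n + 1 : ℕ) : ℂ) * ((z + j) / p)) =
      if p ∣ n + 1 then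
        p * (a (n + 1) * cexp (2 * (Real.pi : ℂ) * Complex.I * ((n + 1 : ℕ) : ℂ) * (z / p)))
      else 0 := by
    intro n
    have e : ∀ j : ℕ, a (n + 1) *
        cexp (2 * (Real.pi : ℂ) * Complex.I * ((n + 1 : ℕ) : ℂ) * ((z + j) / p)) =
        a (n + 1) * cexp (2 * (Real.pi : ℂ) * Complex.I * ((n + 1 : ℕ) : ℂ) * (z / p)) *
        cexp (2 * (Real.pi : ℂ) * Complex.I * ((n + 1 : ℕ) : ℂ) * j / p) := by
      intro j
      rw [mul_assoc (a (n + 1)), ← Complex.exp_add]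
      congr 2
      ring
    simp only [e]
    rw [← Finset.mul_sum, sum_exp_div p (n + 1) hp]
    split_ifs <;> ring
  simp only [hterm]
  rw [tsum_ite_dvd_succ hp fun n =>
    p * (a n * cexp (2 * (Real.pi : ℂ) * Complex.I * (n : ℂ) * (z / p)))]
  refine tsum_congr fun n => ?_
  congr 3
  push_cast
  field_simp

/-- A Hecke recursion of the coefficients, in terms of slash operators. -/
lemma sum_intSlash_qSeries (ha : ∀ n, 1 ≤ n → ‖a n‖ ≤ M * (n : ℝ) ^ A) {p : ℕ} (hp : 0 < p)
    {α β : ℂ} (hrec : ∀ n, n ≠ 0 → a (p * n) = α * a n - if p ∣ n then β * a (n / p) else 0)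
    (m : ℕ) :
    ∑ j ∈ Finset.range p, intSlash m 1 j 0 p (fun z : ℍ => qSeries a z) =
      (p * ((p : ℂ) ^ m)⁻¹ * α) • (fun z : ℍ => qSeries a z) -
        (p * ((p : ℂ) ^ (2 * m))⁻¹ * β) • intSlash m p 0 0 1 (fun z : ℍ => qSeries a z) := by
  have hp0 : (p : ℂ) ≠ 0 := by exact_mod_cast hp.ne'
  ext z
  have him : 0 < ((p : ℂ) * z).im := by
    have : ((p : ℂ) * z).im = p * (z : ℂ).im := by simp
    rw [this]
    have := z.coe_im_pos
    positivity
  have hrhs : ∑' n : ℕ, a (p * (n + 1)) *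
        cexp (2 * (Real.pi : ℂ) * Complex.I * ((n + 1 : ℕ) : ℂ) * z) =
      α * qSeries a z - β * qSeries a (p * z) := by
    have e : ∀ n : ℕ, a (p * (n + 1)) *
        cexp (2 * (Real.pi : ℂ) * Complex.I * ((n + 1 : ℕ) : ℂ) * z) =
        α * (a (n + 1) * cexp (2 * (Real.pi : ℂ) * Complex.I * ((n + 1 : ℕ) : ℂ) * z)) -
        if p ∣ n + 1 then β * (a ((n + 1) / p) *
          cexp (2 * (Real.pi : ℂ) * Complex.I * ((n + 1 : ℕ) : ℂ) * z)) else 0 := by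
      intro n
      rw [hrec _ n.succ_ne_zero]
      split_ifs <;> ring
    have e2 : ∀ n : ℕ, (β * (a (p * (n + 1) / p) *
          cexp (2 * (Real.pi : ℂ) * Complex.I * ((p * (n + 1) : ℕ) : ℂ) * z))) =
        β * (a (n + 1) * cexp (2 * (Real.pi : ℂ) * Complex.I * ((n + 1 : ℕ) : ℂ) * (p * z))) := by
      intro n
      rw [Nat.mul_div_cancel_left _ hp]
      congr 3
      push_cast
      ring
    simp only [e]
    have hs : Summable fun n : ℕ => if p ∣ n + 1 then β * (a ((n + 1) / p) *
          cexp (2 * (Real.pi : ℂ) * Complex.I * ((n + 1 : ℕ) : ℂ) * z)) else 0 := by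
      have h1 := (summable_qSeries ha z.coe_im_pos).mul_left α
      have h2 : Summable fun n : ℕ => a (p * (n + 1)) *
        cexp (2 * (Real.pi : ℂ) * Complex.I * ((n + 1 : ℕ) : ℂ) * z) := by
        refine summable_qSeries (a := fun n => a (p * n)) (M := M * p ^ A) (A := A)
          (fun n hn => ?_) z.coe_im_pos
        refine (ha _ (Nat.mul_pos hp hn)).trans (le_of_eq ?_)
        push_cast
        ring
      refine (h1.sub h2).congr fun n => ?_
      rw [e]
      ring
    rw [Summable.tsum_sub ((summable_qSeries ha z.coe_im_pos).mul_left α) hs,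
      tsum_ite_dvd_succ hp fun n => β * (a (n / p) *
          cexp (2 * (Real.pi : ℂ) * Complex.I * (n : ℂ) * z)), tsum_mul_left]
    simp only [e2]
    rw [tsum_mul_left]
    rfl
  have hj : ∀ j : ℕ, intSlash m 1 j 0 p (fun z : ℍ => qSeries a z) z =
      ((p : ℂ) ^ m)⁻¹ * qSeries a ((z + j) / p) := by
    intro j
    have hj' := im_mobius_pos (a := 1) (b := j) (c := 0) (d := p) (by simpa using hp) z.coe_im_pos
    rw [intSlash_apply, ofComplex_apply_of_im_pos hj']
    simp [two_mul, pow_add, hp0]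
  rw [Finset.sum_apply]
  simp only [hj]
  rw [← Finset.mul_sum, sum_qSeries_add_div ha hp z.coe_im_pos, hrhs]
  have h0 : intSlash m p 0 0 1 (fun z : ℍ => qSeries a z) z = (p : ℂ) ^ m * qSeries a (p * z) := by
    rw [intSlash_apply]
    simp [ofComplex_apply_of_im_pos him]
  simp only [Pi.sub_apply, Pi.smul_apply, smul_eq_mul, h0, two_mul, pow_add]
  field_simp

end hecke

section descent

/-- Euclidean descent on the bottom row of matrices `[a, b; M * c, d]` of determinant one. -/
lemma gamma0_induction {M : ℤ} (hM : 0 < M) {P : ℤ → ℤ → ℤ → ℤ → Prop}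
    (h1 : P 1 0 0 1) (h1' : P (-1) 0 0 (-1))
    (hT : ∀ a b c d, a * d - M * b * c = 1 → (P a (b + a) c (d + M * c) ↔ P a b c d))
    (hstep : ∀ a b c d, a * d - M * b * c = 1 → c ≠ 0 → 2 * |d| ≤ M * |c| →
      (∀ a' b' c' d', a' * d' - M * b' * c' = 1 → |c'| < |c| → P a' b' c' d') → P a b c d)
    (a b c d : ℤ) (hdet : a * d - M * b * c = 1) : P a b c d := by
  have hTn : ∀ t a b c d : ℤ, a * d - M * b * c = 1 →
      (P a (b + t * a) c (d + t * (M * c)) ↔ P a b c d) := by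
    intro t
    induction t using Int.induction_on with
    | zero => simp
    | succ n ih =>
      intro a b c d h
      rw [← ih a b c d h, ← hT a (b + n * a) c (d + n * (M * c)) (by linear_combination h)]
      ring_nf
    | pred n ih =>
      intro a b c d h
      rw [← ih a b c d h, ← hT a (b + (-n - 1) * a) c (d + (-n - 1) * (M * c))
        (by linear_combination h)]
      ring_nf
  have main : ∀ n : ℕ, ∀ a b c d : ℤ, a * d - M * b * c = 1 → |c| < n → P a b c d := by
    intro n
    induction n with
    | zero => intro a b c d _ h; exact absurd h (by simp)
    | succ n ih =>
      intro a b c d h hc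
      by_cases hc0 : c = 0
      · subst hc0
        have had : a * d = 1 := by linarith
        rcases Int.eq_one_or_neg_one_of_mul_eq_one' had with ⟨rfl, rfl⟩ | ⟨rfl, rfl⟩
        · rw [← hTn (-b) 1 b 0 1 h]
          simpa using h1
        · rw [← hTn b (-1) b 0 (-1) h]
          simpa using h1'
      · have hMc : 0 < M * |c| := mul_pos hM (abs_pos.2 hc0)
        have hex : ∃ t : ℤ, 2 * |d + t * (M * c)| ≤ M * |c| := by
          have key : ∃ s : ℤ, 2 * |d + s * (M * |c|)| ≤ M * |c| := by
            generalize M * |c| = K at hMc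
            have e1 := Int.emod_add_mul_ediv d K
            have e2 := Int.emod_nonneg d hMc.ne'
            have e3 := Int.emod_lt_of_pos d hMc
            rcases le_total (2 * (d % K)) K with h' | h'
            · refine ⟨-(d / K), ?_⟩
              rw [show d + -(d / K) * K = d % K by linarith, abs_of_nonneg e2]
              exact h'
            · refine ⟨-(d / K) - 1, ?_⟩
              rw [show d + (-(d / K) - 1) * K = d % K - K by linarith, abs_of_nonpos (by linarith)]
              linarith
          obtain ⟨s, hs⟩ := key
          rcases abs_choice c with h' | h'
          · exact ⟨s, by rwa [h'] at hs ⊢⟩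
          · exact ⟨-s, by
              have e : d + -s * (M * c) = d + s * (M * |c|) := by rw [h']; ring
              rwa [e]⟩
        obtain ⟨t, ht⟩ := hex
        rw [← hTn t a b c d h]
        refine hstep _ _ _ _ (by linear_combination h) hc0 ht fun a' b' c' d' h' hc' => ?_
        exact ih a' b' c' d' h' (by push_cast at hc; linarith [Int.lt_add_one_iff.1 hc])
  obtain ⟨n, hn⟩ := exists_nat_gt |c|
  exact main n a b c d hdet hn

end descent

section level20

variable {m : ℕ} {g : ℍ → ℂ}

/-- The sign of the permutation of the nonzero vectors of `𝔽₂²` induced by a matrix. -/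
noncomputable def modTwoSign (a b c d : ℤ) : ℂ :=
  if (a + b + c + d + b * c : ZMod 2) = 0 then 1 else -1

lemma modTwoSign_mul {a b c d p q r s : ℤ} (h₁ : a * d - 5 * b * c = 1)
    (h₂ : p * s - 5 * q * r = 1) :
    modTwoSign (a * p + 5 * b * r) (a * q + b * s) (c * p + d * r) (5 * c * q + d * s) =
      modTwoSign a b c d * modTwoSign p q r s := by
  have h5 : (5 : ZMod 2) = 1 := rfl
  have h₁' := congrArg (Int.cast : ℤ → ZMod 2) h₁
  have h₂' := congrArg (Int.cast : ℤ → ZMod 2) h₂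
  push_cast at h₁' h₂'
  unfold modTwoSign
  push_cast
  simp only [h5, one_mul] at *
  generalize (a : ZMod 2) = a at *
  generalize (b : ZMod 2) = b at *
  generalize (c : ZMod 2) = c at *
  generalize (d : ZMod 2) = d at *
  generalize (p : ZMod 2) = p at *
  generalize (q : ZMod 2) = q at *
  generalize (r : ZMod 2) = r at *
  generalize (s : ZMod 2) = s at *
  have key : (a * p + b * r) + (a * q + b * s) + (c * p + d * r) + (c * q + d * s) +
      (a * q + b * s) * (c * p + d * r) = 0 ↔
      (a + b + c + d + b * c = 0 ↔ p + q + r + s + q * r = 0) := by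
    clear h₁ h₂ h5
    revert a b c d p q r s
    decide +kernel
  simp only [key]
  split_ifs <;> simp_all

lemma intSlash_level_twenty_generators (hm : 0 < m) (hg : IsHol g) {l : ℂ}
    (hT : intSlash m 1 1 0 1 g = -g) (hW : intSlash m 0 (-1) 5 0 g = g)
    (h3 : intSlash m 3 0 0 1 g + intSlash m 1 0 0 3 g - intSlash m 1 1 0 3 g -
      intSlash m 1 (-1) 0 3 g = l • g) :
    intSlash m 1 (-1) 0 1 g = -g ∧ intSlash m 1 0 5 1 g = -g ∧ intSlash m 1 0 (-5) 1 g = -g ∧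
      intSlash m 2 (-1) 5 (-2) g = -g ∧ intSlash m (-2) (-1) 5 2 g = -g := by
  have hT' : intSlash m 1 (-1) 0 1 g = -g := by
    simpa using intSlash_eq_neg_of_inverse (by norm_num) hT
  have hV : intSlash m 1 0 5 1 g = -g := by
    rw [intSlash_factor 0 (-1) 5 0 (-5) (-1) 5 0 (-5), hW,
      intSlash_factor 1 (-1) 0 1 0 (-1) 5 0 1, hT', map_neg, hW]
  have hV' : intSlash m 1 0 (-5) 1 g = -g := by
    simpa using intSlash_eq_neg_of_inverse (by norm_num) hV
  have h3' := congrArg (intSlash m 0 (-1) 5 0) h3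
  simp only [map_add, map_sub, map_smul, hW] at h3'
  have w1 : intSlash m 0 (-1) 5 0 (intSlash m 3 0 0 1 g) = intSlash m 1 0 0 3 g := by
    rw [intSlash_comp_eq 0 (-3) 5 0 1, intSlash_factor 0 (-1) 5 0 1 0 0 3 1, hW]
  have w2 : intSlash m 0 (-1) 5 0 (intSlash m 1 0 0 3 g) = intSlash m 3 0 0 1 g := by
    rw [intSlash_comp_eq 0 (-1) 15 0 1, intSlash_factor 0 (-1) 5 0 3 0 0 1 1, hW]
  have w3 : intSlash m 0 (-1) 5 0 (intSlash m 1 1 0 3 g) = intSlash m 3 0 (-5) 1 g := by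
    rw [intSlash_comp_eq 5 (-1) 15 0 1, intSlash_factor 0 (-1) 5 0 3 0 (-5) 1 1, hW]
  have w4 : intSlash m 0 (-1) 5 0 (intSlash m 1 (-1) 0 3 g) = intSlash m 3 0 5 1 g := by
    rw [intSlash_comp_eq (-5) (-1) 15 0 1, intSlash_factor 0 (-1) 5 0 3 0 5 1 1, hW]
  rw [w1, w2, w3, w4] at h3'
  set h := intSlash m 2 (-1) 5 (-2) g + g with hh
  have u1 : intSlash m 1 1 0 3 g = intSlash m 3 0 (-5) 1 (intSlash m 1 1 0 1 h + g) := by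
    rw [hh, map_add (intSlash m 1 1 0 1), hT, neg_add_cancel_right,
      intSlash_comp_eq (-2) 1 (-5) 1 1, intSlash_comp_eq 1 1 0 3 1]
  have u2 : intSlash m 1 (-1) 0 3 g = intSlash m 3 0 5 1 (g - h) := by
    have e : g - h = intSlash m 2 (-1) (-5) 3 g := by
      rw [intSlash_factor 1 0 (-5) 1 2 (-1) 5 (-2) 1, hV', map_neg, hh]
      ring
    rw [e, intSlash_comp_eq 1 (-1) 0 3 1]
  rw [u1, u2, map_add, map_sub] at h3
  have h4 : intSlash m 3 0 (-5) 1 (intSlash m 1 1 0 1 h) = intSlash m 3 0 5 1 h := by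
    linear_combination h3' - h3
  have h5 : intSlash m (-7) 3 (-10) 3 h = h := by
    have e := congrArg (intSlash m 1 0 (-5) 3) h4
    rw [intSlash_comp_eq 3 0 (-10) 3 1, intSlash_comp_eq (-7) 3 (-10) 3 1,
      intSlash_comp_eq 1 0 0 1 3, intSlash_self one_ne_zero] at e
    exact e
  have h0 : h = 0 := ((hg.intSlash (by norm_num)).add hg).eq_zero_of_elliptic hm (by norm_num)
    (by norm_num) h5
  have he : intSlash m 2 (-1) 5 (-2) g = -g := eq_neg_of_add_eq_zero_left h0
  refine ⟨hT', hV, hV', he, ?_⟩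
  rw [intSlash_factor 2 (-1) (-5) 3 1 1 0 1 (-1), intSlash_factor 1 0 (-5) 1 2 (-1) 5 (-2) 1
    (A := 2) (B := -1) (C := -5) (D := 3), hV', map_neg, he, neg_neg, hT]

lemma intSlash_eq_modTwoSign_smul
    (hT : intSlash m 1 1 0 1 g = -g) (hT' : intSlash m 1 (-1) 0 1 g = -g)
    (hV : intSlash m 1 0 5 1 g = -g) (hV' : intSlash m 1 0 (-5) 1 g = -g)
    (he : intSlash m 2 (-1) 5 (-2) g = -g) (he' : intSlash m (-2) (-1) 5 2 g = -g)
    {a b c d : ℤ} (hdet : a * d - 5 * b * c = 1) :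
    intSlash m a b (5 * c) d g = modTwoSign a b c d • g := by
  have step : ∀ p q r s : ℤ, p * s - 5 * q * r = 1 → modTwoSign p q r s = -1 →
      intSlash m s (-q) (-(5 * r)) p g = -g → ∀ a b c d : ℤ, a * d - 5 * b * c = 1 →
      intSlash m (a * p + 5 * b * r) (a * q + b * s) (5 * (c * p + d * r)) (5 * c * q + d * s) g =
        modTwoSign (a * p + 5 * b * r) (a * q + b * s) (c * p + d * r) (5 * c * q + d * s) • g →
      intSlash m a b (5 * c) d g = modTwoSign a b c d • g := by
    intro p q r s h₂ hsgn hneg a b c d h₁ h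
    rw [modTwoSign_mul h₁ h₂, hsgn, mul_neg_one] at h
    have := intSlash_eq_smul_of_mul _ _ _ _ (hneg.trans (neg_one_smul ℂ g).symm) h (a := a) (b := b)
      (c := 5 * c) (d := d)
      (by linear_combination (p * s - 5 * q * r) * h₁ + h₂) (by linear_combination h₂)
      (by linear_combination a * h₂) (by linear_combination b * h₂)
      (by linear_combination 5 * c * h₂) (by linear_combination d * h₂)
    rwa [neg_mul_neg, mul_one] at this
  refine gamma0_induction (P := fun a b c d => intSlash m a b (5 * c) d g = modTwoSign a b c d • g)
    (by norm_num) ?_ ?_ ?_ ?_ a b c d hdet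
  · rw [mul_zero, intSlash_self one_ne_zero]
    simp [modTwoSign, show (1 : ZMod 2) + 1 = 0 from rfl]
  · rw [mul_zero, intSlash_self (by norm_num)]
    simp [modTwoSign, show (1 : ZMod 2) + 1 = 0 from rfl]
  · intro a b c d h
    constructor
    · intro h'
      refine step 1 1 0 1 (by norm_num) ?_ (by simpa using hT') a b c d h ?_
      · simp [modTwoSign, show (1 : ZMod 2) + 1 = 0 from rfl]
      · convert h' using 2 <;> ring_nf
    · intro h'
      refine step 1 (-1) 0 1 (by norm_num) ?_ (by simpa using hT) _ _ c _
        (by linear_combination h) ?_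
      · simp [modTwoSign, show (1 : ZMod 2) + 1 = 0 from rfl]
      · convert h' using 2 <;> ring_nf
  · intro a b c d h hc hd ih
    have hd0 : d ≠ 0 := by
      rintro rfl
      have : (5 : ℤ) ∣ 1 := ⟨-(b * c), by linarith⟩
      norm_num at this
    have hcase : |c + d| < |c| ∨ |c - d| < |c| ∨ |2 * c + d| < |c| ∨ |-(2 * c) + d| < |c| := by
      rcases abs_cases c with hc' | hc' <;> rcases abs_cases d with hd' | hd' <;>
        simp only [abs_lt] <;> omega
    rcases hcase with h' | h' | h' | h'
    · refine step 1 0 1 1 (by norm_num) ?_ (by simpa using hV') a b c d h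
        (ih _ _ _ _ (by linear_combination h) (by simpa using h'))
      simp [modTwoSign, show (1 : ZMod 2) + 1 = 0 from rfl]
    · refine step 1 0 (-1) 1 (by norm_num) ?_ (by simpa using hV) a b c d h
        (ih _ _ _ _ (by linear_combination h) (by simpa [← sub_eq_add_neg] using h'))
      simp [modTwoSign, show (1 : ZMod 2) + 1 = 0 from rfl]
    · refine step 2 (-1) 1 (-2) (by norm_num) (by simp [modTwoSign]; decide) ?_ a b c d h
        (ih _ _ _ _ (by linear_combination h) (by simpa [mul_comm c 2] using h'))
      have := intSlash_scalar_mul (m := m) (h := g) (r := -1) (by norm_num) 2 (-1) 5 (-2)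
      simpa [he] using this
    · refine step (-2) (-1) 1 2 (by norm_num) (by simp [modTwoSign]; decide) ?_ a b c d h
        (ih _ _ _ _ (by linear_combination h) (by simpa [mul_comm c 2] using h'))
      have := intSlash_scalar_mul (m := m) (h := g) (r := -1) (by norm_num) (-2) (-1) 5 2
      simpa [he'] using this

end level20

section level24

variable {m : ℕ} {g : ℍ → ℂ}

lemma intSlash_level_twentyFour_unipotent
    (hT : intSlash m 1 1 0 1 g = -g) (hW : intSlash m 0 (-1) 6 0 g = g) :
    intSlash m 1 (-1) 0 1 g = -g ∧ intSlash m 1 0 6 1 g = -g ∧ intSlash m 1 0 (-6) 1 g = -g := by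
  have hT' : intSlash m 1 (-1) 0 1 g = -g := by
    simpa using intSlash_eq_neg_of_inverse (by norm_num) hT
  have hV : intSlash m 1 0 6 1 g = -g := by
    rw [intSlash_factor 0 (-1) 6 0 (-6) (-1) 6 0 (-6), hW,
      intSlash_factor 1 (-1) 0 1 0 (-1) 6 0 1, hT', map_neg, hW]
  exact ⟨hT', hV, by simpa using intSlash_eq_neg_of_inverse (by norm_num) hV⟩

/-- The `U₃` relation and its Fricke conjugate. -/
lemma intSlash_level_twentyFour_threefold
    (hT : intSlash m 1 1 0 1 g = -g) (hW : intSlash m 0 (-1) 6 0 g = g)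
    (h3 : intSlash m 1 0 0 3 g - intSlash m 1 1 0 3 g - intSlash m 1 (-1) 0 3 g = g) :
    2 * g + intSlash m 3 1 6 3 g + intSlash m 3 (-1) (-6) 3 g = 0 := by
  obtain ⟨hT', hV, hV'⟩ := intSlash_level_twentyFour_unipotent hT hW
  have h3' := congrArg (intSlash m 0 (-1) 6 0) h3
  simp only [map_sub, hW] at h3'
  rw [intSlash_fricke_comp (by norm_num) (by norm_num) _ hW,
    intSlash_fricke_comp (by norm_num) (by norm_num) _ hW,
    intSlash_fricke_comp (by norm_num) (by norm_num) _ hW] at h3'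
  norm_num at h3'
  have b0 := congrArg (intSlash m 3 0 0 1) h3
  have b1 := congrArg (intSlash m 3 0 6 1) h3
  have b2 := congrArg (intSlash m 3 0 (-6) 1) h3
  simp only [map_sub] at b0 b1 b2
  rw [intSlash_comp_eq 1 0 0 1 3, intSlash_self one_ne_zero, intSlash_comp_eq 3 1 0 3 1,
    intSlash_comp_eq 3 (-1) 0 3 1] at b0
  have c1 : intSlash m 3 0 6 1 (intSlash m 1 1 0 3 g) =
      intSlash m 3 0 0 1 (intSlash m 3 1 6 3 g) := by
    rw [intSlash_comp_eq 9 1 18 3 1, intSlash_comp_eq 9 1 18 3 1]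
  have c2 : intSlash m 3 0 6 1 (intSlash m 1 (-1) 0 3 g) = -intSlash m 3 1 0 3 g := by
    rw [intSlash_comp_eq (-3) (-1) 18 3 1, intSlash_factor 1 0 (-6) 1 3 1 0 3 (-1), hV', map_neg]
  have c3 : intSlash m 3 0 (-6) 1 (intSlash m 1 (-1) 0 3 g) =
      intSlash m 3 0 0 1 (intSlash m 3 (-1) (-6) 3 g) := by
    rw [intSlash_comp_eq 9 (-1) (-18) 3 1, intSlash_comp_eq 9 (-1) (-18) 3 1]
  have c4 : intSlash m 3 0 (-6) 1 (intSlash m 1 1 0 3 g) = -intSlash m 3 (-1) 0 3 g := by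
    rw [intSlash_comp_eq (-3) 1 (-18) 3 1, intSlash_factor 1 0 6 1 3 (-1) 0 3 (-1), hV, map_neg]
  rw [c1, c2, intSlash_comp_eq 1 0 6 1 3, hV] at b1
  rw [c3, c4, intSlash_comp_eq 1 0 (-6) 1 3, hV'] at b2
  have key : intSlash m 3 0 0 1 (2 * g + intSlash m 3 1 6 3 g + intSlash m 3 (-1) (-6) 3 g) = 0 := by
    rw [two_mul]
    simp only [map_add]
    linear_combination h3' - b0 - b1 - b2
  have := congrArg (intSlash m 1 0 0 3) key
  rwa [intSlash_comp_eq 1 0 0 1 3, intSlash_self one_ne_zero, map_zero] at this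

lemma intSlash_level_twentyFour_generators (hm : 0 < m) (hg : IsHol g) {l : ℂ}
    (hT : intSlash m 1 1 0 1 g = -g) (hW : intSlash m 0 (-1) 6 0 g = g)
    (h3 : intSlash m 1 0 0 3 g - intSlash m 1 1 0 3 g - intSlash m 1 (-1) 0 3 g = g)
    (h5 : intSlash m 5 0 0 1 g + intSlash m 1 0 0 5 g + intSlash m 1 2 0 5 g +
      intSlash m 1 (-2) 0 5 g - intSlash m 1 1 0 5 g - intSlash m 1 (-1) 0 5 g = l • g) :
    intSlash m 5 2 12 5 g = g ∧ intSlash m 5 (-2) (-12) 5 g = g := by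
  obtain ⟨hT', hV, hV'⟩ := intSlash_level_twentyFour_unipotent hT hW
  have hrel := intSlash_level_twentyFour_threefold hT hW h3
  obtain ⟨h, hh⟩ : ∃ h, h = intSlash m 3 (-2) 6 (-3) g - g := ⟨_, rfl⟩
  have hω : intSlash m 3 (-2) 6 (-3) g = h + g := by rw [hh]; ring
  have hw : intSlash m 3 1 6 3 g = intSlash m 1 1 0 1 h - g := by
    rw [intSlash_factor 3 (-2) 6 (-3) 1 1 0 1 1, hω, map_add, hT]; ring
  have hw' : intSlash m 3 (-1) (-6) 3 g = -h - g := by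
    rw [intSlash_factor 1 (-1) 0 1 3 (-2) 6 (-3) (-1), hT', map_neg, hω]; ring
  have hTh : intSlash m 1 1 0 1 h = h := by
    rw [hw, hw'] at hrel
    linear_combination hrel
  rw [hTh] at hw
  have hωh : intSlash m 3 (-2) 6 (-3) h = -h := by
    rw [hh, map_sub, intSlash_comp_eq 1 0 0 1 (-3), intSlash_self one_ne_zero]
    ring
  have hT'h : intSlash m 1 (-1) 0 1 h = h := by
    simpa using intSlash_eq_of_inverse (by norm_num) hTh
  have hWh : intSlash m 0 (-1) 6 0 h = -h := by
    have e : intSlash m 0 (-1) 6 0 (intSlash m 3 (-1) (-6) 3 g) = intSlash m 3 1 6 3 g := by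
      rw [intSlash_comp_eq (-6) (-3) 18 6 1, intSlash_factor 0 (-1) 6 0 3 1 6 3 1, hW]
    rw [hw, hw', map_sub, map_neg, hW] at e
    linear_combination -e
  have hVh' : intSlash m 1 0 (-6) 1 h = h := by
    rw [intSlash_factor 0 (-1) 6 0 6 (-1) 6 0 (-6), hWh, map_neg,
      intSlash_factor 1 1 0 1 0 (-1) 6 0 1, hTh, hWh, neg_neg]
  have hρ : intSlash m 5 2 12 5 g = g - 2 * h := by
    have e : intSlash m 3 1 6 3 h = -h := by
      rw [intSlash_factor 3 (-2) 6 (-3) 1 1 0 1 1, hωh, map_neg, hTh]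
    rw [intSlash_factor 3 1 6 3 3 1 6 3 3, hw, map_sub, e, hw]
    ring
  have hρ' : intSlash m 5 (-2) (-12) 5 g = g + 2 * h := by
    have e : intSlash m 3 (-1) (-6) 3 h = -h := by
      rw [intSlash_factor 1 (-1) 0 1 3 (-2) 6 (-3) (-1), hT'h, hωh]
    rw [intSlash_factor 3 (-1) (-6) 3 3 (-1) (-6) 3 3, hw', map_sub, map_neg, e, hw']
    ring
  have h5' := congrArg (intSlash m 0 (-1) 6 0) h5
  simp only [map_add, map_sub, map_smul, hW] at h5'
  rw [intSlash_fricke_comp' (by norm_num) (by norm_num) hW,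
    intSlash_fricke_comp (by norm_num) (by norm_num) _ hW,
    intSlash_fricke_comp (by norm_num) (by norm_num) _ hW,
    intSlash_fricke_comp (by norm_num) (by norm_num) _ hW,
    intSlash_fricke_comp (by norm_num) (by norm_num) _ hW,
    intSlash_fricke_comp (by norm_num) (by norm_num) _ hW] at h5'
  norm_num at h5'
  have a1 : intSlash m 1 1 0 5 g = intSlash m 5 0 6 1 g := by
    have e : intSlash m 1 (-1) 6 (-5) g = g := by
      rw [intSlash_factor 1 0 6 1 1 (-1) 0 1 1 (A := 1) (B := -1) (C := 6) (D := -5), hV, map_neg,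
        hT', neg_neg]
    rw [intSlash_factor 1 (-1) 6 (-5) 5 0 6 1 (-1) (A := 1) (B := 1) (C := 0) (D := 5), e]
  have a1' : intSlash m 1 (-1) 0 5 g = intSlash m 5 0 (-6) 1 g := by
    have e : intSlash m 1 1 (-6) (-5) g = g := by
      rw [intSlash_factor 1 0 (-6) 1 1 1 0 1 1 (A := 1) (B := 1) (C := -6) (D := -5), hV', map_neg,
        hT, neg_neg]
    rw [intSlash_factor 1 1 (-6) (-5) 5 0 (-6) 1 (-1) (A := 1) (B := -1) (C := 0) (D := 5), e]
  have a2 : intSlash m 1 2 0 5 g = intSlash m 5 0 (-12) 1 (g - 2 * h) := by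
    rw [← hρ, intSlash_comp_eq 1 2 0 5 1]
  have a2' : intSlash m 1 (-2) 0 5 g = intSlash m 5 0 12 1 (g + 2 * h) := by
    rw [← hρ', intSlash_comp_eq 1 (-2) 0 5 1]
  rw [a1, a1', a2, a2', two_mul, map_add, map_add, map_sub, map_add] at h5
  have h6 : intSlash m 5 0 12 1 h = intSlash m 5 0 (-12) 1 h := by
    have e : 2 * intSlash m 5 0 12 1 h = 2 * intSlash m 5 0 (-12) 1 h := by
      linear_combination h5 - h5'
    funext z
    simpa using congrFun e z
  have h7 : intSlash m 5 0 24 5 h = h := by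
    have := congrArg (intSlash m 1 0 12 5) h6
    rwa [intSlash_comp_eq 5 0 24 5 1, intSlash_comp_eq 1 0 0 1 5, intSlash_self one_ne_zero] at this
  have h8 : intSlash m 5 0 (-6) 5 h = h := by
    rw [intSlash_factor 1 0 (-6) 1 5 0 24 5 1, hVh', h7]
  have h9 : intSlash m 5 1 0 5 h = h := by
    rw [intSlash_factor 6 (-5) 30 0 0 (-1) 6 0 (-6),
      intSlash_factor 0 (-1) 6 0 5 0 (-6) 5 1 (A := 6) (B := -5) (C := 30) (D := 0), hWh, map_neg,
      h8, map_neg, hWh, neg_neg]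
  have h0 : h = 0 := by
    have hhol : IsHol h := by
      rw [hh]
      exact (hg.intSlash (by norm_num)).sub hg
    refine hhol.eq_zero_of_elliptic (a := 19) (b := 5) (c := -30) (d := 25) hm (by norm_num)
      (by norm_num) ?_
    rw [intSlash_factor 5 1 0 5 5 0 (-6) 5 1, h9, h8]
  rw [hρ, hρ', h0]
  simp

/-- The sign by which `Γ₀(6)` acts on `f ∣ [1 0; 0 2]` for a form `f` of level `24`. -/
noncomputable def offDiagSign (b c : ℤ) : ℂ := if (b + c : ZMod 2) = 0 then 1 else -1

lemma offDiagSign_mul {a b c d p q r s : ℤ} (h₁ : a * d - 6 * b * c = 1)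
    (h₂ : p * s - 6 * q * r = 1) :
    offDiagSign (a * q + b * s) (c * p + d * r) = offDiagSign b c * offDiagSign q r := by
  have h6 : (6 : ZMod 2) = 0 := rfl
  have h₁' := congrArg (Int.cast : ℤ → ZMod 2) h₁
  have h₂' := congrArg (Int.cast : ℤ → ZMod 2) h₂
  push_cast at h₁' h₂'
  unfold offDiagSign
  push_cast
  simp only [h6, zero_mul, sub_zero] at *
  generalize (a : ZMod 2) = a at *
  generalize (b : ZMod 2) = b at *
  generalize (c : ZMod 2) = c at *
  generalize (d : ZMod 2) = d at *
  generalize (p : ZMod 2) = p at *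
  generalize (q : ZMod 2) = q at *
  generalize (r : ZMod 2) = r at *
  generalize (s : ZMod 2) = s at *
  have key : (a * q + b * s) + (c * p + d * r) = 0 ↔ (b + c = 0 ↔ q + r = 0) := by
    clear h₁ h₂ h6
    revert a b c d p q r s
    decide +kernel
  simp only [key]
  split_ifs <;> simp_all

lemma intSlash_eq_offDiagSign_smul
    (hT : intSlash m 1 1 0 1 g = -g) (hT' : intSlash m 1 (-1) 0 1 g = -g)
    (hV : intSlash m 1 0 6 1 g = -g) (hV' : intSlash m 1 0 (-6) 1 g = -g)
    (hρ : intSlash m 5 2 12 5 g = g) (hρ' : intSlash m 5 (-2) (-12) 5 g = g)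
    {a b c d : ℤ} (hdet : a * d - 6 * b * c = 1) :
    intSlash m a b (6 * c) d g = offDiagSign b c • g := by
  have step : ∀ p q r s : ℤ, p * s - 6 * q * r = 1 →
      intSlash m s (-q) (-(6 * r)) p g = offDiagSign q r • g → ∀ a b c d : ℤ,
      a * d - 6 * b * c = 1 →
      intSlash m (a * p + 6 * b * r) (a * q + b * s) (6 * (c * p + d * r)) (6 * c * q + d * s) g =
        offDiagSign (a * q + b * s) (c * p + d * r) • g →
      intSlash m a b (6 * c) d g = offDiagSign b c • g := by
    intro p q r s h₂ hinv a b c d h₁ h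
    rw [offDiagSign_mul h₁ h₂] at h
    have hsq : offDiagSign q r * offDiagSign q r = 1 := by
      unfold offDiagSign
      split_ifs <;> norm_num
    have := intSlash_eq_smul_of_mul _ _ _ _ hinv h (a := a) (b := b) (c := 6 * c) (d := d)
      (by linear_combination (p * s - 6 * q * r) * h₁ + h₂) (by linear_combination h₂)
      (by linear_combination a * h₂) (by linear_combination b * h₂)
      (by linear_combination 6 * c * h₂) (by linear_combination d * h₂)
    rwa [mul_assoc, hsq, mul_one] at this
  refine gamma0_induction (P := fun a b c d => intSlash m a b (6 * c) d g = offDiagSign b c • g)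
    (by norm_num) ?_ ?_ ?_ ?_ a b c d hdet
  · rw [mul_zero, intSlash_self one_ne_zero]
    simp [offDiagSign]
  · rw [mul_zero, intSlash_self (by norm_num)]
    simp [offDiagSign]
  · intro a b c d h
    constructor
    · intro h'
      refine step 1 1 0 1 (by norm_num) ?_ a b c d h ?_
      · simpa [offDiagSign] using hT'
      · convert h' using 2 <;> ring_nf
    · intro h'
      refine step 1 (-1) 0 1 (by norm_num) ?_ _ _ c _ (by linear_combination h) ?_
      · simpa [offDiagSign] using hT
      · convert h' using 2 <;> ring_nf
  · intro a b c d h hc hd ih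
    have hd2 : ¬ (2 : ℤ) ∣ d := by
      rintro ⟨e, rfl⟩
      have : (2 : ℤ) ∣ 1 := ⟨a * e - 3 * (b * c), by linarith⟩
      norm_num at this
    have hd3 : ¬ (3 : ℤ) ∣ d := by
      rintro ⟨e, rfl⟩
      have : (3 : ℤ) ∣ 1 := ⟨a * e - 2 * (b * c), by linarith⟩
      norm_num at this
    have hcase : |c + d| < |c| ∨ |c - d| < |c| ∨ |5 * c + 2 * d| < |c| ∨ |5 * c - 2 * d| < |c| := by
      rcases abs_cases c with hc' | hc' <;> rcases abs_cases d with hd' | hd' <;>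
        simp only [abs_lt] <;> omega
    have h0 : offDiagSign 2 2 = 1 := by simp [offDiagSign]; decide
    have h0' : offDiagSign (-2) (-2) = 1 := by simp [offDiagSign]; decide
    rcases hcase with h' | h' | h' | h'
    · refine step 1 0 1 1 (by norm_num) ?_ a b c d h
        (ih _ _ _ _ (by linear_combination h) (by simpa using h'))
      simpa [offDiagSign] using hV'
    · refine step 1 0 (-1) 1 (by norm_num) ?_ a b c d h
        (ih _ _ _ _ (by linear_combination h) (by simpa [← sub_eq_add_neg] using h'))
      simpa [offDiagSign] using hV
    · refine step 5 2 2 5 (by norm_num) ?_ a b c d h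
        (ih _ _ _ _ (by linear_combination h) (by simpa [mul_comm] using h'))
      simpa [h0] using hρ'
    · refine step 5 (-2) (-2) 5 (by norm_num) ?_ a b c d h
        (ih _ _ _ _ (by linear_combination h) (by simpa [mul_comm, ← sub_eq_add_neg] using h'))
      simpa [h0'] using hρ

end level24

section level18

variable {m : ℕ} {g : ℍ → ℂ}

lemma intSlash_level_eighteen_unipotent
    (hT3 : g + intSlash m 1 1 0 1 g + intSlash m 1 2 0 1 g = 0)
    (hW : intSlash m 0 (-1) 2 0 g = g) :
    intSlash m 1 (-1) 0 1 g = -g - intSlash m 1 1 0 1 g ∧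
    intSlash m 1 0 (-2) 1 g = -g - intSlash m 1 0 2 1 g ∧
    intSlash m 1 0 (-6) 1 g = g := by
  have hc : intSlash m 1 3 0 1 g = g := by
    have := congrArg (intSlash m 1 1 0 1) hT3
    simp only [map_add, map_zero] at this
    rw [intSlash_comp_eq 1 2 0 1 1, intSlash_comp_eq 1 3 0 1 1] at this
    linear_combination this - hT3
  have hT' : intSlash m 1 (-1) 0 1 g = -g - intSlash m 1 1 0 1 g := by
    have : intSlash m 1 (-1) 0 1 g = intSlash m 1 2 0 1 g := by
      rw [intSlash_factor 1 3 0 1 1 (-1) 0 1 1 (A := 1) (B := 2), hc]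
    rw [this]
    linear_combination hT3
  have hV : intSlash m 1 0 2 1 g = intSlash m 0 (-1) 2 0 (intSlash m 1 (-1) 0 1 g) := by
    rw [intSlash_factor 0 (-1) 2 0 (-2) (-1) 2 0 (-2), hW,
      intSlash_factor 1 (-1) 0 1 0 (-1) 2 0 1]
  have hV' : intSlash m 1 0 (-2) 1 g = intSlash m 0 (-1) 2 0 (intSlash m 1 1 0 1 g) := by
    rw [intSlash_factor 0 (-1) 2 0 2 (-1) 2 0 (-2), hW,
      intSlash_factor 1 1 0 1 0 (-1) 2 0 1]
  refine ⟨hT', ?_, ?_⟩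
  · rw [hV, hV', hT', map_sub, map_neg, hW]
    ring
  · rw [intSlash_factor 0 (-1) 2 0 6 (-1) 2 0 (-2), hW,
      intSlash_factor 1 3 0 1 0 (-1) 2 0 1, hc, hW]

lemma intSlash_level_eighteen_relation
    (hT3 : g + intSlash m 1 1 0 1 g + intSlash m 1 2 0 1 g = 0)
    (hW : intSlash m 0 (-1) 2 0 g = g)
    (hU : intSlash m 1 0 0 2 g + intSlash m 1 3 0 2 g = g) :
    intSlash m 3 (-1) (-8) 3 g = -g := by
  obtain ⟨-, -, hV3⟩ := intSlash_level_eighteen_unipotent hT3 hW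
  have hU' := congrArg (intSlash m 0 (-1) 2 0) hU
  rw [map_add, intSlash_fricke_comp (by norm_num) (by norm_num) _ hW,
    intSlash_fricke_comp (by norm_num) (by norm_num) _ hW, hW] at hU'
  norm_num at hU'
  have b0 := congrArg (intSlash m 2 0 0 1) hU
  have b1 := congrArg (intSlash m 2 0 (-6) 1) hU
  rw [map_add, intSlash_comp_eq 1 0 0 1 2, intSlash_self one_ne_zero,
    intSlash_comp_eq 2 3 0 2 1] at b0
  have c1 : intSlash m 2 0 (-6) 1 (intSlash m 1 3 0 2 g) =
      intSlash m 2 0 0 1 (intSlash m (-8) 3 (-6) 2 g) := by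
    rw [intSlash_comp_eq (-16) 3 (-12) 2 1, intSlash_comp_eq (-16) 3 (-12) 2 1]
  rw [map_add, intSlash_comp_eq 1 0 (-6) 1 2, hV3, c1] at b1
  have key : intSlash m 2 0 0 1 (intSlash m (-8) 3 (-6) 2 g + g) = 0 := by
    rw [map_add]
    linear_combination b1 + hU'
  have h0 := congrArg (intSlash m 1 0 0 2) key
  rw [intSlash_comp_eq 1 0 0 1 2, intSlash_self one_ne_zero, map_zero] at h0
  rw [intSlash_factor 0 (-1) 2 0 (-8) 3 (-6) 2 2, hW]
  exact eq_neg_of_add_eq_zero_left h0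

/-- The function attached to a point of `ℙ¹(𝔽₃)` in a realisation of the reflection
representation of `PSL₂(𝔽₃)` spanned by `x, y, u`. -/
def projLineVector (x y u : ℍ → ℂ) (v w : ZMod 3) : ℍ → ℂ :=
  if w = 0 then 0 else if v = 0 then x + y + u else if v = w then x + u else u

lemma intSlash_level_eighteen_action
    (hT3 : g + intSlash m 1 1 0 1 g + intSlash m 1 2 0 1 g = 0)
    (hW : intSlash m 0 (-1) 2 0 g = g)
    (hU : intSlash m 1 0 0 2 g + intSlash m 1 3 0 2 g = g)
    {G : ZMod 3 → ZMod 3 → ℍ → ℂ}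
    (hG : G = projLineVector g (intSlash m 1 1 0 1 g) (intSlash m 1 0 2 1 g)) :
    (∀ v w, intSlash m 1 1 0 1 (G v w) = G (v - w) w) ∧
    (∀ v w, intSlash m 1 (-1) 0 1 (G v w) = G (v + w) w) ∧
    (∀ v w, ¬ (v = 0 ∧ w = 0) → intSlash m 1 0 2 1 (G v w) = G v (w + v) - G 1 1) ∧
    (∀ v w, ¬ (v = 0 ∧ w = 0) → intSlash m 1 0 (-2) 1 (G v w) = G v (w - v) - G 2 1) := by
  obtain ⟨hT', hV', hV3⟩ := intSlash_level_eighteen_unipotent hT3 hW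
  have he := intSlash_level_eighteen_relation hT3 hW hU
  have he' : intSlash m 3 1 8 3 g = -g := by
    simpa using intSlash_eq_neg_of_inverse (by norm_num) he
  have hV3' : intSlash m 1 0 6 1 g = g := by
    simpa using intSlash_eq_of_inverse (by norm_num) hV3
  have he'' : intSlash m 3 4 2 3 g = -g := by
    rw [intSlash_factor 0 (-1) 2 0 (-2) (-3) 6 8 (-2), hW,
      intSlash_factor 3 (-1) (-8) 3 0 (-1) 2 0 1, he, map_neg, hW]
  have hTy : intSlash m 1 1 0 1 (intSlash m 1 1 0 1 g) = -g - intSlash m 1 1 0 1 g := by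
    rw [intSlash_comp_eq 1 2 0 1 1]
    linear_combination hT3
  have hTu : intSlash m 1 1 0 1 (intSlash m 1 0 2 1 g) = g + intSlash m 1 0 2 1 g := by
    rw [intSlash_comp_eq 1 1 2 3 1, intSlash_factor 3 1 8 3 1 0 (-2) 1 1, he', map_neg, hV']
    ring
  have hVu : intSlash m 1 0 2 1 (intSlash m 1 0 2 1 g) = -g - intSlash m 1 0 2 1 g := by
    rw [intSlash_comp_eq 1 0 4 1 1, intSlash_factor 1 0 6 1 1 0 (-2) 1 1, hV3', hV']
  have hVy : intSlash m 1 0 2 1 (intSlash m 1 1 0 1 g) = g + intSlash m 1 1 0 1 g := by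
    rw [intSlash_comp_eq 3 1 2 1 1, intSlash_factor 3 4 2 3 1 (-1) 0 1 1, he'', map_neg, hT']
    ring
  have hT'y : intSlash m 1 (-1) 0 1 (intSlash m 1 1 0 1 g) = g := by
    rw [intSlash_comp_eq 1 0 0 1 1, intSlash_self one_ne_zero]
  have hV'u : intSlash m 1 0 (-2) 1 (intSlash m 1 0 2 1 g) = g := by
    rw [intSlash_comp_eq 1 0 0 1 1, intSlash_self one_ne_zero]
  have hT'u : intSlash m 1 (-1) 0 1 (intSlash m 1 0 2 1 g) =
      g + intSlash m 1 1 0 1 g + intSlash m 1 0 2 1 g := by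
    have := congrArg (intSlash m 1 (-1) 0 1) hTu
    rw [intSlash_comp_eq 1 0 0 1 1, intSlash_self one_ne_zero, map_add, hT'] at this
    linear_combination -this
  have hV'y : intSlash m 1 0 (-2) 1 (intSlash m 1 1 0 1 g) =
      g + intSlash m 1 1 0 1 g + intSlash m 1 0 2 1 g := by
    have := congrArg (intSlash m 1 0 (-2) 1) hVy
    rw [intSlash_comp_eq 1 0 0 1 1, intSlash_self one_ne_zero, map_add, hV'] at this
    linear_combination -this
  have hz : ∀ v : ZMod 3, v = 0 ∨ v = 1 ∨ v = 2 := by decide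
  have e₁ : (1 : ZMod 3) + 1 = 2 := rfl
  have e₂ : (1 : ZMod 3) + 2 = 0 := rfl
  have e₃ : (2 : ZMod 3) + 1 = 0 := rfl
  have e₄ : (2 : ZMod 3) + 2 = 1 := rfl
  have e₅ : (1 : ZMod 3) - 2 = 2 := rfl
  have e₆ : (2 : ZMod 3) - 1 = 1 := rfl
  have e₇ : -(1 : ZMod 3) = 2 := rfl
  have e₈ : -(2 : ZMod 3) = 1 := rfl
  have n₁ : (2 : ZMod 3) ≠ 0 := by decide
  have n₂ : (1 : ZMod 3) ≠ 2 := by decide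
  subst hG
  unfold projLineVector
  refine ⟨fun v w => ?_, fun v w => ?_, fun v w => ?_, fun v w => ?_⟩ <;>
  rcases hz v with rfl | rfl | rfl <;> rcases hz w with rfl | rfl | rfl <;>
  simp only [e₁, e₂, e₃, e₄, e₅, e₆, e₇, e₈, n₁, n₁.symm, n₂, n₂.symm, one_ne_zero, zero_ne_one,
    if_true, if_false, map_zero, map_add, add_zero, zero_add, sub_zero, zero_sub, sub_self,
    and_self, and_true, and_false, not_true_eq_false, not_false_eq_true, false_imp_iff,
    true_imp_iff, hTy, hTu, hVu, hVy, hT'y, hV'u, hT'u, hV'y, hT', hV'] <;>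
  ring

lemma intSlash_eq_projLineVector_sub
    (hT3 : g + intSlash m 1 1 0 1 g + intSlash m 1 2 0 1 g = 0)
    (hW : intSlash m 0 (-1) 2 0 g = g)
    (hU : intSlash m 1 0 0 2 g + intSlash m 1 3 0 2 g = g)
    {G : ZMod 3 → ZMod 3 → ℍ → ℂ}
    (hG : G = projLineVector g (intSlash m 1 1 0 1 g) (intSlash m 1 0 2 1 g))
    {a b c d : ℤ} (hdet : a * d - 2 * b * c = 1) :
    intSlash m a b (2 * c) d g = G (d - b) (a - 2 * c) - G (-d - b) (a + 2 * c) := by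
  obtain ⟨aT, aT', aV, aV'⟩ := intSlash_level_eighteen_action hT3 hW hU hG
  have step : ∀ p q r s : ℤ, p * s - 2 * q * r = 1 →
      (∃ K, ∀ v w : ZMod 3, ¬ (v = 0 ∧ w = 0) →
        intSlash m s (-q) (-(2 * r)) p (G v w) = G (p * v + q * w) (2 * r * v + s * w) - K) →
      ∀ a b c d : ℤ, a * d - 2 * b * c = 1 →
      intSlash m (a * p + 2 * b * r) (a * q + b * s) (2 * (c * p + d * r)) (2 * c * q + d * s) g =
        G ((2 * c * q + d * s : ℤ) - (a * q + b * s : ℤ))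
          ((a * p + 2 * b * r : ℤ) - 2 * (c * p + d * r : ℤ)) -
        G (-(2 * c * q + d * s : ℤ) - (a * q + b * s : ℤ))
          ((a * p + 2 * b * r : ℤ) + 2 * (c * p + d * r : ℤ)) →
      intSlash m a b (2 * c) d g = G (d - b) (a - 2 * c) - G (-d - b) (a + 2 * c) := by
    rintro p q r s h₂ ⟨K, hK⟩ a b c d h₁ h
    have h₂' := congrArg (Int.cast : ℤ → ZMod 3) h₂
    have h₁' := congrArg (Int.cast : ℤ → ZMod 3) h₁
    push_cast at h₁' h₂'
    have h₁₂ : (((a * p + 2 * b * r : ℤ) : ZMod 3) * (2 * c * q + d * s : ℤ) -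
        2 * (a * q + b * s : ℤ) * (c * p + d * r : ℤ)) = 1 := by
      push_cast
      linear_combination (p * s - 2 * q * r : ZMod 3) * h₁' + h₂'
    rw [intSlash_factor (a * p + 2 * b * r) (a * q + b * s) (2 * (c * p + d * r))
      (2 * c * q + d * s) s (-q) (-(2 * r)) p 1 one_ne_zero
      (by nlinarith) (by nlinarith)
      (by linear_combination a * h₂) (by linear_combination b * h₂)
      (by linear_combination 2 * c * h₂) (by linear_combination d * h₂), h, map_sub, hK, hK]
    · rw [sub_sub_sub_cancel_right]
      congr 2 <;> push_cast
      · linear_combination (d - b : ZMod 3) * h₂'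
      · linear_combination (a - 2 * c : ZMod 3) * h₂'
      · linear_combination (-d - b : ZMod 3) * h₂'
      · linear_combination (a + 2 * c : ZMod 3) * h₂'
    all_goals
      rintro ⟨z₁, z₂⟩
      refine one_ne_zero (α := ZMod 3) ?_
      linear_combination ((2 * c * q + d * s : ℤ) : ZMod 3) * z₂ +
        2 * ((c * p + d * r : ℤ) : ZMod 3) * z₁ - h₁₂
  have n : (-1 : ZMod 3) ≠ 1 := by decide
  have n' : (1 : ZMod 3) ≠ -1 := by decide
  have h3 : (3 : ZMod 3) = 0 := rfl
  refine gamma0_induction (P := fun a b c d => intSlash m a b (2 * c) d g =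
    G (d - b) (a - 2 * c) - G (-d - b) (a + 2 * c)) (by norm_num) ?_ ?_ ?_ ?_ a b c d hdet
  · rw [mul_zero, intSlash_self one_ne_zero]
    subst hG
    simp [projLineVector, n]
  · rw [mul_zero, intSlash_self (by norm_num)]
    subst hG
    simp [projLineVector, n']
  · intro a b c d h
    constructor
    · intro h'
      refine step 1 1 0 1 (by norm_num) ⟨0, fun v w _ => ?_⟩ a b c d h ?_
      · simpa using aT' v w
      · convert h' using 2 <;> push_cast <;> ring_nf
    · intro h'
      refine step 1 (-1) 0 1 (by norm_num) ⟨0, fun v w _ => ?_⟩ _ _ c _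
        (by linear_combination h) ?_
      · simpa [← sub_eq_add_neg] using aT v w
      · convert h' using 2 <;> push_cast <;> ring_nf
  · intro a b c d h hc hd ih
    have hd2 : ¬ (2 : ℤ) ∣ d := by
      rintro ⟨e, rfl⟩
      have : (2 : ℤ) ∣ 1 := ⟨a * e - b * c, by linarith⟩
      norm_num at this
    have hcase : |c + d| < |c| ∨ |c - d| < |c| := by
      rcases abs_cases c with hc' | hc' <;> rcases abs_cases d with hd' | hd' <;>
        simp only [abs_lt] <;> omega
    rcases hcase with h' | h'
    · refine step 1 0 1 1 (by norm_num) ⟨G 2 1, fun v w hvw => ?_⟩ a b c d h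
        (ih _ _ _ _ (by linear_combination h) (by simpa using h'))
      have e : w - v = 2 * v + w := by linear_combination -v * h3
      simpa [e] using aV' v w hvw
    · refine step 1 0 (-1) 1 (by norm_num) ⟨G 1 1, fun v w hvw => ?_⟩ a b c d h
        (ih _ _ _ _ (by linear_combination h) (by simpa [← sub_eq_add_neg] using h'))
      have e : w + v = 2 * (-1) * v + w := by linear_combination v * h3
      simpa [e] using aV v w hvw

lemma intSlash_eq_self_of_level_eighteen
    (hT3 : g + intSlash m 1 1 0 1 g + intSlash m 1 2 0 1 g = 0)
    (hW : intSlash m 0 (-1) 2 0 g = g)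
    (hU : intSlash m 1 0 0 2 g + intSlash m 1 3 0 2 g = g)
    {a b c d : ℤ} (hdet : a * d - 18 * b * c = 1) :
    intSlash m a (3 * b) (6 * c) d g = g := by
  rw [show 6 * c = 2 * (3 * c) by ring, intSlash_eq_projLineVector_sub hT3 hW hU rfl
    (by linear_combination hdet)]
  have h3 : (3 : ZMod 3) = 0 := rfl
  have h18 : (18 : ZMod 3) = 0 := rfl
  have hdet' := congrArg (Int.cast : ℤ → ZMod 3) hdet
  push_cast at hdet' ⊢
  simp only [h3, h18, zero_mul, mul_zero, sub_zero, add_zero] at hdet' ⊢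
  have key : ∀ x y : ZMod 3, x * y = 1 → x = 1 ∧ y = 1 ∨ x = -1 ∧ y = -1 := by decide
  have n : (-1 : ZMod 3) ≠ 1 := by decide
  have n' : (1 : ZMod 3) ≠ -1 := by decide
  rcases key _ _ hdet' with ⟨ha, hd⟩ | ⟨ha, hd⟩ <;> rw [ha, hd] <;>
    simp [projLineVector, n, n']

end level18

section descent

variable {m : ℕ} {f : ℍ → ℂ}

lemma intSlash_eq_self_of_hecke_eighteen
    (hW : intSlash m 0 (-1) 18 0 f = f)
    (h2 : intSlash m 1 0 0 2 f + intSlash m 1 1 0 2 f = f)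
    (h3 : intSlash m 1 0 0 3 f + intSlash m 1 1 0 3 f + intSlash m 1 2 0 3 f = 0)
    {a b c d : ℤ} (hdet : a * d - 18 * b * c = 1) : intSlash m a b (18 * c) d f = f := by
  obtain ⟨g, hg⟩ : ∃ g, g = intSlash m 1 0 0 3 f := ⟨_, rfl⟩
  have hf : f = intSlash m 3 0 0 1 g := by
    rw [hg, intSlash_comp_eq 1 0 0 1 3, intSlash_self one_ne_zero]
  have hgW : intSlash m 0 (-1) 2 0 g = g := by
    rw [hg, intSlash_comp_eq 0 (-1) 6 0 1, intSlash_factor 0 (-1) 18 0 1 0 0 3 3, hW]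
  have hgT : g + intSlash m 1 1 0 1 g + intSlash m 1 2 0 1 g = 0 := by
    rw [hg, intSlash_comp_eq 1 1 0 3 1, intSlash_comp_eq 1 2 0 3 1, h3]
  have hgU : intSlash m 1 0 0 2 g + intSlash m 1 3 0 2 g = g := by
    have := congrArg (intSlash m 1 0 0 3) h2
    rw [map_add, ← hg, intSlash_comp_eq 1 0 0 6 1, intSlash_comp_eq 1 3 0 6 1] at this
    rw [hg, intSlash_comp_eq 1 0 0 6 1, intSlash_comp_eq 1 3 0 6 1, this, hg]
  have := intSlash_eq_self_of_level_eighteen hgT hgW hgU hdet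
  nth_rw 1 [hf]
  rw [intSlash_comp_eq (3 * a) (3 * b) (18 * c) d 1 one_ne_zero (by norm_num)
    (by linear_combination hdet.symm.le) (by ring) (by ring) (by ring) (by ring),
    intSlash_factor a (3 * b) (6 * c) d 3 0 0 1 1 one_ne_zero
    (by linear_combination hdet.symm.le) (by norm_num) (by ring) (by ring) (by ring) (by ring),
    this, ← hf]

lemma intSlash_eq_self_of_hecke_twenty (hm : 0 < m) (hol : IsHol f) {l : ℂ}
    (hW : intSlash m 0 (-1) 20 0 f = f)
    (h2 : intSlash m 1 0 0 2 f + intSlash m 1 1 0 2 f = 0)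
    (h3 : intSlash m 1 0 0 3 f + intSlash m 1 1 0 3 f + intSlash m 1 2 0 3 f =
      l • f - intSlash m 3 0 0 1 f)
    {a b c d : ℤ} (hdet : a * d - 20 * b * c = 1) : intSlash m a b (20 * c) d f = f := by
  obtain ⟨g, hg⟩ : ∃ g, g = intSlash m 1 0 0 2 f := ⟨_, rfl⟩
  have hf : f = intSlash m 2 0 0 1 g := by
    rw [hg, intSlash_comp_eq 1 0 0 1 2, intSlash_self one_ne_zero]
  have hgW : intSlash m 0 (-1) 5 0 g = g := by
    rw [hg, intSlash_comp_eq 0 (-1) 10 0 1, intSlash_factor 0 (-1) 20 0 1 0 0 2 2, hW]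
  have hgT : intSlash m 1 1 0 1 g = -g := by
    rw [hg, intSlash_comp_eq 1 1 0 2 1]
    linear_combination h2
  have hg3 : intSlash m 3 0 0 1 g + intSlash m 1 0 0 3 g - intSlash m 1 1 0 3 g -
      intSlash m 1 (-1) 0 3 g = l • g := by
    have h := congrArg (intSlash m 1 0 0 2) h3
    have e₁ : intSlash m 1 2 0 3 g = -intSlash m 1 (-1) 0 3 g := by
      rw [intSlash_factor 1 1 0 1 1 (-1) 0 3 1, hgT, map_neg]
    have e₂ : intSlash m 1 4 0 3 g = -intSlash m 1 1 0 3 g := by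
      rw [intSlash_factor 1 1 0 1 1 1 0 3 1, hgT, map_neg]
    have e₃ : intSlash m 3 0 0 1 g = intSlash m 1 0 0 2 (intSlash m 3 0 0 1 f) := by
      rw [hg, intSlash_comp_eq 3 0 0 2 1, intSlash_comp_eq 3 0 0 2 1]
    simp only [map_add, map_sub, map_smul, ← e₃, ← hg] at h
    rw [intSlash_comp_eq 1 0 0 6 1, intSlash_comp_eq 1 2 0 6 1, intSlash_comp_eq 1 4 0 6 1,
      intSlash_factor 1 0 0 2 1 0 0 3 1 (A := 1) (B := 0),
      intSlash_factor 1 0 0 2 1 2 0 3 1 (A := 1) (B := 2),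
      intSlash_factor 1 0 0 2 1 4 0 3 1 (A := 1) (B := 4), ← hg, e₁, e₂] at h
    linear_combination h
  obtain ⟨hT', hV, hV', he, he'⟩ := intSlash_level_twenty_generators hm
    (hg ▸ hol.intSlash (by norm_num)) hgT hgW hg3
  have h := intSlash_eq_modTwoSign_smul hgT hT' hV hV' he he' (a := a) (b := 2 * b) (c := 2 * c)
    (d := d) (by linear_combination hdet)
  have hsign : modTwoSign a (2 * b) (2 * c) d = 1 := by
    have h2 : (2 : ZMod 2) = 0 := rfl
    have h20 : (20 : ZMod 2) = 0 := rfl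
    have hdet' := congrArg (Int.cast : ℤ → ZMod 2) hdet
    unfold modTwoSign
    push_cast at hdet' ⊢
    simp only [h2, h20, zero_mul, add_zero, sub_zero] at hdet' ⊢
    have key : ∀ x y : ZMod 2, x * y = 1 → x + y = 0 := by decide
    simp [key _ _ hdet']
  rw [hsign, one_smul] at h
  nth_rw 1 [hf]
  rw [intSlash_comp_eq (2 * a) (2 * b) (20 * c) d 1 one_ne_zero (by norm_num)
    (by linear_combination hdet.symm.le) (by ring) (by ring) (by ring) (by ring),
    intSlash_factor a (2 * b) (5 * (2 * c)) d 2 0 0 1 1 one_ne_zero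
    (by linear_combination hdet.symm.le) (by norm_num) (by ring) (by ring) (by ring) (by ring),
    h, ← hf]

lemma intSlash_eq_self_of_hecke_twentyFour (hm : 0 < m) (hol : IsHol f) {l : ℂ}
    (hW : intSlash m 0 (-1) 24 0 f = f)
    (h2 : intSlash m 1 0 0 2 f + intSlash m 1 1 0 2 f = 0)
    (h3 : intSlash m 1 0 0 3 f + intSlash m 1 1 0 3 f + intSlash m 1 2 0 3 f = f)
    (h5 : intSlash m 1 0 0 5 f + intSlash m 1 1 0 5 f + intSlash m 1 2 0 5 f +
      intSlash m 1 3 0 5 f + intSlash m 1 4 0 5 f = l • f - intSlash m 5 0 0 1 f)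
    {a b c d : ℤ} (hdet : a * d - 24 * b * c = 1) : intSlash m a b (24 * c) d f = f := by
  obtain ⟨g, hg⟩ : ∃ g, g = intSlash m 1 0 0 2 f := ⟨_, rfl⟩
  have hf : f = intSlash m 2 0 0 1 g := by
    rw [hg, intSlash_comp_eq 1 0 0 1 2, intSlash_self one_ne_zero]
  have hgW : intSlash m 0 (-1) 6 0 g = g := by
    rw [hg, intSlash_comp_eq 0 (-1) 12 0 1, intSlash_factor 0 (-1) 24 0 1 0 0 2 2, hW]
  have hgT : intSlash m 1 1 0 1 g = -g := by
    rw [hg, intSlash_comp_eq 1 1 0 2 1]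
    linear_combination h2
  have hg3 : intSlash m 1 0 0 3 g - intSlash m 1 1 0 3 g - intSlash m 1 (-1) 0 3 g = g := by
    have h := congrArg (intSlash m 1 0 0 2) h3
    have e₁ : intSlash m 1 2 0 3 g = -intSlash m 1 (-1) 0 3 g := by
      rw [intSlash_factor 1 1 0 1 1 (-1) 0 3 1, hgT, map_neg]
    have e₂ : intSlash m 1 4 0 3 g = -intSlash m 1 1 0 3 g := by
      rw [intSlash_factor 1 1 0 1 1 1 0 3 1, hgT, map_neg]
    simp only [map_add, ← hg] at h
    rw [intSlash_comp_eq 1 0 0 6 1, intSlash_comp_eq 1 2 0 6 1, intSlash_comp_eq 1 4 0 6 1,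
      intSlash_factor 1 0 0 2 1 0 0 3 1 (A := 1) (B := 0),
      intSlash_factor 1 0 0 2 1 2 0 3 1 (A := 1) (B := 2),
      intSlash_factor 1 0 0 2 1 4 0 3 1 (A := 1) (B := 4), ← hg, e₁, e₂] at h
    linear_combination h
  have hg5 : intSlash m 5 0 0 1 g + intSlash m 1 0 0 5 g + intSlash m 1 2 0 5 g +
      intSlash m 1 (-2) 0 5 g - intSlash m 1 1 0 5 g - intSlash m 1 (-1) 0 5 g = l • g := by
    have h := congrArg (intSlash m 1 0 0 2) h5
    have e₁ : intSlash m 1 4 0 5 g = -intSlash m 1 (-1) 0 5 g := by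
      rw [intSlash_factor 1 1 0 1 1 (-1) 0 5 1, hgT, map_neg]
    have e₂ : intSlash m 1 6 0 5 g = -intSlash m 1 1 0 5 g := by
      rw [intSlash_factor 1 1 0 1 1 1 0 5 1, hgT, map_neg]
    have e₃ : intSlash m 1 8 0 5 g = intSlash m 1 (-2) 0 5 g := by
      rw [intSlash_factor 1 1 0 1 1 3 0 5 1, hgT, map_neg, intSlash_factor 1 1 0 1 1 (-2) 0 5 1,
        hgT, map_neg, neg_neg]
    have e₄ : intSlash m 5 0 0 1 g = intSlash m 1 0 0 2 (intSlash m 5 0 0 1 f) := by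
      rw [hg, intSlash_comp_eq 5 0 0 2 1, intSlash_comp_eq 5 0 0 2 1]
    simp only [map_add, map_sub, map_smul, ← e₄, ← hg] at h
    rw [intSlash_comp_eq 1 0 0 10 1, intSlash_comp_eq 1 2 0 10 1, intSlash_comp_eq 1 4 0 10 1,
      intSlash_comp_eq 1 6 0 10 1, intSlash_comp_eq 1 8 0 10 1,
      intSlash_factor 1 0 0 2 1 0 0 5 1 (A := 1) (B := 0),
      intSlash_factor 1 0 0 2 1 2 0 5 1 (A := 1) (B := 2),
      intSlash_factor 1 0 0 2 1 4 0 5 1 (A := 1) (B := 4),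
      intSlash_factor 1 0 0 2 1 6 0 5 1 (A := 1) (B := 6),
      intSlash_factor 1 0 0 2 1 8 0 5 1 (A := 1) (B := 8), ← hg, e₁, e₂, e₃] at h
    linear_combination h
  obtain ⟨hT', hV, hV'⟩ := intSlash_level_twentyFour_unipotent hgT hgW
  obtain ⟨hρ, hρ'⟩ := intSlash_level_twentyFour_generators hm
    (hg ▸ hol.intSlash (by norm_num)) hgT hgW hg3 hg5
  have h := intSlash_eq_offDiagSign_smul hgT hT' hV hV' hρ hρ' (a := a) (b := 2 * b) (c := 2 * c)
    (d := d) (by linear_combination hdet)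
  have hsign : offDiagSign (2 * b) (2 * c) = 1 := by
    have h2 : (2 : ZMod 2) = 0 := rfl
    simp [offDiagSign, h2]
  rw [hsign, one_smul] at h
  nth_rw 1 [hf]
  rw [intSlash_comp_eq (2 * a) (2 * b) (24 * c) d 1 one_ne_zero (by norm_num)
    (by linear_combination hdet.symm.le) (by ring) (by ring) (by ring) (by ring),
    intSlash_factor a (2 * b) (6 * (2 * c)) d 2 0 0 1 1 one_ne_zero
    (by linear_combination hdet.symm.le) (by norm_num) (by ring) (by ring) (by ring) (by ring),
    h, ← hf]

end descent

lemma isHol_qSeries {a : ℕ → ℂ} {M : ℝ} {A : ℕ}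
    (ha : ∀ n : ℕ, 1 ≤ n → ‖a n‖ ≤ M * (n : ℝ) ^ A) : IsHol fun z : ℍ => qSeries a z :=
  (differentiableOn_qSeries ha).congr fun z hz => by
    simp [ofComplex_apply_of_im_pos hz]

lemma intSlash_qSeries_fricke {a : ℕ → ℂ} {m N : ℕ} (hN : 0 < N)
    (h : ∀ z : ℂ, 0 < z.im →
      (N : ℂ) ^ m * z ^ (2 * m) * qSeries a z = qSeries a (-1 / (N * z))) :
    intSlash m 0 (-1) N 0 (fun z : ℍ => qSeries a z) = fun z : ℍ => qSeries a z := by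
  ext z
  have hN' : (0 : ℤ) < 0 * 0 - (-1) * N := by simpa using hN
  have hpos := im_mobius_pos hN' z.im_pos
  rw [intSlash_apply, ofComplex_apply_of_im_pos hpos]
  have hz : (z : ℂ) ≠ 0 := z.ne_zero
  have hN0 : (N : ℂ) ≠ 0 := by exact_mod_cast hN.ne'
  have := h z z.im_pos
  simp only [Int.cast_zero, zero_mul, zero_add, add_zero, Int.cast_neg, Int.cast_one,
    Int.cast_natCast, zero_sub, neg_mul, one_mul, neg_neg]
  rw [← this, mul_pow, two_mul, pow_add, pow_add]
  field_simp

lemma coeff_prime_mul_of_localFactors {a : ℕ → ℂ} {σ : ℝ} {m N : ℕ} (hm : 0 < m)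
    (hbound : ∃ M : ℝ, ∀ n : ℕ, 1 ≤ n → ‖a n‖ ≤ M * (n : ℝ) ^ σ) {L : ℂ → ℂ}
    (hL : ∀ s : ℂ, σ + 1 < s.re →
      HasSum (fun n : ℕ => a (n + 1) * ((n + 1 : ℕ) : ℂ) ^ (-s)) (L s))
    (heuler : ∀ s : ℂ, σ + 1 < s.re →
      L s = ∏' p : Nat.Primes,
        if ¬ ((p : ℕ) ∣ N) then
          (1 - a p * ((p : ℕ) : ℂ) ^ (-s) + ((p : ℕ) : ℂ) ^ (((2 * m : ℕ) : ℂ) - 1 - 2 * s))⁻¹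
        else if ¬ ((p : ℕ) ^ 2 ∣ N) then (1 - ((p : ℕ) : ℂ) ^ ((m : ℂ) - 1 - s))⁻¹
        else 1) {p : ℕ} (hp : p.Prime) {n : ℕ} (hn : n ≠ 0) :
    a (p * n) =
      (if ¬ p ∣ N then a p else if ¬ p ^ 2 ∣ N then (p : ℂ) ^ (m - 1) else 0) * a n -
        if p ∣ n then (if ¬ p ∣ N then (p : ℂ) ^ (2 * m - 1) else 0) * a (n / p) else 0 := by
  have hnorm (q : ℕ) (hq : q.Prime) (e : ℕ) (he : e ≤ 2 * m) :
      ‖(q : ℂ) ^ e‖ ≤ (q : ℝ) ^ (2 * m) := by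
    rw [norm_pow, Complex.norm_natCast]
    exact pow_le_pow_right₀ (by exact_mod_cast hq.one_le) he
  refine coeff_prime_mul_of_eulerProduct (A := 2 * m)
    (α := fun p => if ¬ p ∣ N then a p else if ¬ p ^ 2 ∣ N then (p : ℂ) ^ (m - 1) else 0)
    (β := fun p => if ¬ p ∣ N then (p : ℂ) ^ (2 * m - 1) else 0) hbound hL ?_ ?_ ?_ hp hn
  · intro s hs
    rw [heuler s hs]
    refine tprod_congr fun q => ?_
    have hq0 : ((q : ℕ) : ℂ) ≠ 0 := by exact_mod_cast q.2.ne_zero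
    have e₁ : ((q : ℕ) : ℂ) ^ (((2 * m : ℕ) : ℂ) - 1 - 2 * s) =
        ((q : ℕ) : ℂ) ^ (2 * m - 1) * (((q : ℕ) : ℂ) ^ (-s)) ^ 2 := by
      rw [← cpow_nat_mul, ← cpow_natCast, ← cpow_add _ _ hq0, Nat.cast_sub (by omega)]
      congr 1
      push_cast
      ring
    have e₂ : ((q : ℕ) : ℂ) ^ ((m : ℂ) - 1 - s) =
        ((q : ℕ) : ℂ) ^ (m - 1) * ((q : ℕ) : ℂ) ^ (-s) := by
      rw [← cpow_natCast, ← cpow_add _ _ hq0, Nat.cast_sub (by omega)]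
      congr 1
      push_cast
      ring
    rw [e₁, e₂]
    split_ifs <;> simp
  · intro q hq
    split_ifs
    · exact Or.inr (by simp)
    · exact Or.inr (hnorm q hq _ (by omega))
    · exact Or.inl le_rfl
  · intro q hq
    split_ifs
    · simp
    · exact hnorm q hq _ (by omega)

/-- **Converse theorem for level `N ∈ {18, 20, 24}` (no twisting).**
Suppose `(aₙ)` are complex numbers with `aₙ = O(n^σ)`, whose Dirichlet series `L_f`
has the Euler product of a level-`N` form of even weight `k`, and whose completion
`Λ_f(s) = (2π)^{-s} Γ(s) L_f(s)` is entire, bounded on vertical strips and satisfies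
`Λ_f(s) = (-1)^{k/2} N^{k/2 - s} Λ_f(k - s)`. Then `f(z) = ∑ₙ aₙ e^{2πinz}` is a
modular form of weight `k` on `Γ₀(N)` (holomorphic on `ℍ`, transforming correctly
under `Γ₀(N)`, and holomorphic at the cusps). -/
theorem converse_theorem_no_twists_18_20_24
    (k : ℕ) (hk : 0 < k) (hkeven : Even k)
    (N : ℕ) (hN : N = 18 ∨ N = 20 ∨ N = 24)
    (a : ℕ → ℂ) (σ : ℝ) (hσ : 0 < σ)
    (hbound : ∃ M : ℝ, ∀ n : ℕ, 1 ≤ n → ‖a n‖ ≤ M * (n : ℝ) ^ σ)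
    (L : ℂ → ℂ)
    (hL : ∀ s : ℂ, σ + 1 < s.re →
      HasSum (fun n : ℕ => a (n + 1) * ((n + 1 : ℕ) : ℂ) ^ (-s)) (L s))
    (heuler : ∀ s : ℂ, σ + 1 < s.re →
      L s = ∏' p : Nat.Primes,
        if ¬ ((p : ℕ) ∣ N) then
          (1 - a p * ((p : ℕ) : ℂ) ^ (-s) + ((p : ℕ) : ℂ) ^ ((k : ℂ) - 1 - 2 * s))⁻¹
        else if ¬ ((p : ℕ) ^ 2 ∣ N) then
          (1 - ((p : ℕ) : ℂ) ^ ((k : ℂ) / 2 - 1 - s))⁻¹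
        else 1)
    (Λ : ℂ → ℂ)
    (hΛ : ∀ s : ℂ, σ + 1 < s.re →
      Λ s = (2 * (Real.pi : ℂ)) ^ (-s) * Complex.Gamma s * L s)
    (hΛdiff : Differentiable ℂ Λ)
    (hΛbdd : ∀ A B : ℝ, ∃ C : ℝ, ∀ s : ℂ, A ≤ s.re → s.re ≤ B → ‖Λ s‖ ≤ C)
    (hFE : ∀ s : ℂ, Λ s = (-1 : ℂ) ^ (k / 2) * (N : ℂ) ^ ((k : ℂ) / 2 - s) * Λ ((k : ℂ) - s)) :
    ∃ F : ModularForm (CongruenceSubgroup.Gamma0 N) k,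
      ∀ z : ℍ, F z =
        ∑' n : ℕ, a (n + 1) * Complex.exp (2 * (Real.pi : ℂ) * Complex.I * ((n + 1 : ℕ) : ℂ) * (z : ℂ)) := by
  obtain ⟨m, rfl⟩ := hkeven.two_dvd
  have hm : 0 < m := by omega
  have hN0 : 0 < N := by omega
  obtain ⟨M, hM⟩ := hbound
  have ha : ∀ n, 1 ≤ n → ‖a n‖ ≤ |M| * (n : ℝ) ^ ⌈σ⌉₊ := by
    intro n hn
    have hn' : (1 : ℝ) ≤ n := by exact_mod_cast hn
    refine (hM n hn).trans (mul_le_mul (le_abs_self M) ?_ (by positivity) (abs_nonneg M))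
    rw [← Real.rpow_natCast]
    exact Real.rpow_le_rpow_of_exponent_le hn' (Nat.le_ceil σ)
  have hdiv : 2 * m / 2 = m := by omega
  have hdiv' : ((2 * m : ℕ) : ℂ) / 2 = m := by push_cast; ring
  rw [hdiv, hdiv'] at hFE
  rw [hdiv'] at heuler
  push_cast at hFE
  set f : ℍ → ℂ := fun z => qSeries a z with hf
  have hW : intSlash m 0 (-1) N 0 f = f := intSlash_qSeries_fricke hN0 fun z hz =>
    qSeries_fricke ha hL hΛ hΛdiff hΛbdd hN0 hFE hz
  have hrec := fun p hp n hn => coeff_prime_mul_of_localFactors (m := m) hm ⟨M, hM⟩ hL heuler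
    (p := p) hp (n := n) hn
  have hol : IsHol f := isHol_qSeries ha
  have hgood : ∀ p : ℕ, p.Prime → ¬ p ∣ N → ∃ l : ℂ,
      ∑ j ∈ Finset.range p, intSlash m 1 j 0 p f = l • f - intSlash m p 0 0 1 f := by
    intro p hp hpN
    have hp0 : (p : ℂ) ≠ 0 := by exact_mod_cast hp.ne_zero
    refine ⟨p * ((p : ℂ) ^ m)⁻¹ * a p, ?_⟩
    rw [sum_intSlash_qSeries ha hp.pos (fun n hn => hrec p hp n hn) m, if_pos hpN, if_pos hpN]
    have e : (p : ℂ) * ((p : ℂ) ^ (2 * m))⁻¹ * (p : ℂ) ^ (2 * m - 1) = 1 := by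
      rw [show (p : ℂ) ^ (2 * m) = p * (p : ℂ) ^ (2 * m - 1) by
        rw [← pow_succ', Nat.sub_add_cancel (by omega)]]
      field_simp
    rw [e, one_smul]
  have hmult : ∀ p : ℕ, p.Prime → p ∣ N → ¬ p ^ 2 ∣ N →
      ∑ j ∈ Finset.range p, intSlash m 1 j 0 p f = f := by
    intro p hp hpN hpN'
    have hp0 : (p : ℂ) ≠ 0 := by exact_mod_cast hp.ne_zero
    have e : (p : ℂ) * ((p : ℂ) ^ m)⁻¹ * (p : ℂ) ^ (m - 1) = 1 := by
      rw [show (p : ℂ) ^ m = p * (p : ℂ) ^ (m - 1) by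
        rw [← pow_succ', Nat.sub_add_cancel (by omega)]]
      field_simp
    rw [sum_intSlash_qSeries ha hp.pos (fun n hn => hrec p hp n hn) m, if_neg (not_not.2 hpN),
      if_neg (not_not.2 hpN), if_pos hpN', e, one_smul, mul_zero, zero_smul, sub_zero]
  have hzero : ∀ p : ℕ, p.Prime → p ^ 2 ∣ N →
      ∑ j ∈ Finset.range p, intSlash m 1 j 0 p f = 0 := by
    intro p hp hpN
    have hpN' : p ∣ N := (dvd_pow_self p two_ne_zero).trans hpN
    rw [sum_intSlash_qSeries ha hp.pos (fun n hn => hrec p hp n hn) m, if_neg (not_not.2 hpN'),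
      if_neg (not_not.2 hpN'), if_neg (not_not.2 hpN)]
    simp
  have hinv : ∀ a b c d : ℤ, a * d - N * b * c = 1 → intSlash m a b (N * c) d f = f := by
    rcases hN with rfl | rfl | rfl
    · intro a b c d hdet
      have h2 := hmult 2 Nat.prime_two (by norm_num) (by norm_num)
      have h3 := hzero 3 Nat.prime_three (by norm_num)
      simp only [Finset.sum_range_succ, Finset.sum_range_zero, zero_add] at h2 h3
      exact intSlash_eq_self_of_hecke_eighteen hW (by simpa using h2) (by simpa using h3) hdet
    · intro a b c d hdet
      have h2 := hzero 2 Nat.prime_two (by norm_num)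
      obtain ⟨l, h3⟩ := hgood 3 Nat.prime_three (by norm_num)
      simp only [Finset.sum_range_succ, Finset.sum_range_zero, zero_add] at h2 h3
      exact intSlash_eq_self_of_hecke_twenty hm hol hW (by simpa using h2) (by simpa using h3) hdet
    · intro a b c d hdet
      have h2 := hzero 2 Nat.prime_two (by norm_num)
      have h3 := hmult 3 Nat.prime_three (by norm_num) (by norm_num)
      obtain ⟨l, h5⟩ := hgood 5 Nat.prime_five (by norm_num)
      simp only [Finset.sum_range_succ, Finset.sum_range_zero, zero_add] at h2 h3 h5
      exact intSlash_eq_self_of_hecke_twentyFour hm hol hW (by simpa using h2) (by simpa using h3)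
        (by simpa using h5) hdet
  obtain ⟨C, -, hC⟩ := exists_norm_qSeries_le ha 0
  refine exists_modularForm_of_moderate_growth hN0 (differentiableOn_qSeries ha) hC ?_
  rintro a' b' c' d' hdet ⟨c', rfl⟩ z hz
  have := congrFun (hinv a' b' c' d' (by linear_combination hdet)) ⟨z, hz⟩
  have hdet' : 0 < a' * d' - b' * (N * c') := by rw [hdet]; norm_num
  rw [intSlash_apply, hf, ofComplex_apply_of_im_pos (im_mobius_pos hdet' hz), hdet] at this
  have hw := mobius_denom_ne_zero hdet' hz
  rw [Int.cast_one, one_pow, one_mul, inv_mul_eq_iff_eq_mul₀ (pow_ne_zero _ hw)] at this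
  exact this
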